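/- arXiv:1103.5500 — 2 statements merged into one kernel-verified Lean document; each statement's English description precedes it below -/
import Mathlib

section
/- Assume the parameters are generic, i.e. for each i the only pair (d,d') ∈ ℤ² with r_i^d s_i^{d'} = 1 is (0,0). Then the multiparameter Weyl algebra A_{r,s}(n) is a left and right Noetherian domain. -/
namespace MTW

/-- Generators of the multiparameter Weyl algebra `A_{r,s}(n)`:
`ρ_i, ρ_i^{-1}, σ_i, σ_i^{-1}, x_i, y_i`. -/
inductive WGen (n : ℕ) : Type
  | rho (i : Fin n)
  | rhoInv (i : Fin n)
  | sg (i : Fin n)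
  | sgInv (i : Fin n)
  | x (i : Fin n)
  | y (i : Fin n)

/-- The four families of "torus" generators `ρ_i^{±1}, σ_i^{±1}`. -/
def tor (n : ℕ) (p : Fin n × Fin 4) : WGen n :=
  ![WGen.rho p.1, WGen.rhoInv p.1, WGen.sg p.1, WGen.sgInv p.1] p.2

/-- Generators as elements of the free algebra. -/
noncomputable def gi (K : Type) [Field K] (n : ℕ) (g : WGen n) : FreeAlgebra K (WGen n) :=
  FreeAlgebra.ι K g

/-- The defining relations (R1)–(R5) of the multiparameter Weyl algebra `A_{r,s}(n)`. -/
inductive WRel (K : Type) [Field K] (n : ℕ) (r s : Fin n → K) :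
    FreeAlgebra K (WGen n) → FreeAlgebra K (WGen n) → Prop
  /- (R1) the `ρ_i^{±1}, σ_j^{±1}` all commute -/
  | torComm (p q : Fin n × Fin 4) :
      WRel K n r s (gi K n (tor n p) * gi K n (tor n q)) (gi K n (tor n q) * gi K n (tor n p))
  /- (R1) `ρ_i ρ_i^{-1} = 1 = ρ_i^{-1} ρ_i` -/
  | rhoUnit (i : Fin n) : WRel K n r s (gi K n (.rho i) * gi K n (.rhoInv i)) 1
  | rhoUnit' (i : Fin n) : WRel K n r s (gi K n (.rhoInv i) * gi K n (.rho i)) 1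
  /- (R1) `σ_i σ_i^{-1} = 1 = σ_i^{-1} σ_i` -/
  | sgUnit (i : Fin n) : WRel K n r s (gi K n (.sg i) * gi K n (.sgInv i)) 1
  | sgUnit' (i : Fin n) : WRel K n r s (gi K n (.sgInv i) * gi K n (.sg i)) 1
  /- (R2) `ρ_i x_j = r_i^{δ_{ij}} x_j ρ_i`, `ρ_i y_j = r_i^{-δ_{ij}} y_j ρ_i` -/
  | rhoX (i j : Fin n) : WRel K n r s (gi K n (.rho i) * gi K n (.x j))
      ((if i = j then r i else 1) • (gi K n (.x j) * gi K n (.rho i)))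
  | rhoY (i j : Fin n) : WRel K n r s (gi K n (.rho i) * gi K n (.y j))
      ((if i = j then (r i)⁻¹ else 1) • (gi K n (.y j) * gi K n (.rho i)))
  /- (R3) `σ_i x_j = s_i^{δ_{ij}} x_j σ_i`, `σ_i y_j = s_i^{-δ_{ij}} y_j σ_i` -/
  | sgX (i j : Fin n) : WRel K n r s (gi K n (.sg i) * gi K n (.x j))
      ((if i = j then s i else 1) • (gi K n (.x j) * gi K n (.sg i)))
  | sgY (i j : Fin n) : WRel K n r s (gi K n (.sg i) * gi K n (.y j))
      ((if i = j then (s i)⁻¹ else 1) • (gi K n (.y j) * gi K n (.sg i)))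
  /- (R4) -/
  | xComm (i j : Fin n) : WRel K n r s (gi K n (.x i) * gi K n (.x j)) (gi K n (.x j) * gi K n (.x i))
  | yComm (i j : Fin n) : WRel K n r s (gi K n (.y i) * gi K n (.y j)) (gi K n (.y j) * gi K n (.y i))
  | yxComm (i j : Fin n) (h : i ≠ j) :
      WRel K n r s (gi K n (.y i) * gi K n (.x j)) (gi K n (.x j) * gi K n (.y i))
  /- (R5) `y_i x_i − r_i² x_i y_i = σ_i²` and `y_i x_i − s_i² x_i y_i = ρ_i²` -/
  | weylR (i : Fin n) : WRel K n r s
      (gi K n (.y i) * gi K n (.x i) - (r i ^ 2) • (gi K n (.x i) * gi K n (.y i)))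
      (gi K n (.sg i) * gi K n (.sg i))
  | weylS (i : Fin n) : WRel K n r s
      (gi K n (.y i) * gi K n (.x i) - (s i ^ 2) • (gi K n (.x i) * gi K n (.y i)))
      (gi K n (.rho i) * gi K n (.rho i))

/-- The multiparameter Weyl algebra `A_{r,s}(n)`, presented by generators and relations. -/
noncomputable abbrev MWA (K : Type) [Field K] (n : ℕ) (r s : Fin n → K) : Type :=
  RingQuot (WRel K n r s)

/-- The additive subgroup `∑_{i < m} x ^ i * f(B)` of a ring `S`, for a ring homomorphism
`f : B → S` and an element `x` of `S`. -/
def powFiltration {B S : Type*} [Ring B] [Ring S] (f : B →+* S) (x : S) (m : ℕ) :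
    AddSubgroup S :=
  AddSubgroup.closure {a | ∃ i < m, ∃ b, a = x ^ i * f b}

namespace powFiltration

variable {B S : Type*} [Ring B] [Ring S] {f : B →+* S} {x : S}

theorem pow_mul_mem {i m : ℕ} (h : i < m) (b : B) : x ^ i * f b ∈ powFiltration f x m :=
  AddSubgroup.subset_closure ⟨i, h, b, rfl⟩

theorem mono {m k : ℕ} (h : m ≤ k) : powFiltration f x m ≤ powFiltration f x k :=
  AddSubgroup.closure_mono fun _ ⟨i, hi, b, hb⟩ => ⟨i, hi.trans_le h, b, hb⟩

theorem eq_zero_of_mem_zero {a : S} (ha : a ∈ powFiltration f x 0) : a = 0 := by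
  simpa [powFiltration] using ha

/-- To show that left or right multiplication maps one filtration step into a subgroup, it is
enough to look at the monomials. -/
theorem map_mem {m : ℕ} {G : AddSubgroup S} (φ : S →+ S)
    (h : ∀ i < m, ∀ b, φ (x ^ i * f b) ∈ G) {a : S} (ha : a ∈ powFiltration f x m) : φ a ∈ G := by
  have : powFiltration f x m ≤ G.comap φ := by
    refine (AddSubgroup.closure_le _).2 ?_
    rintro _ ⟨i, hi, b, rfl⟩
    exact h i hi b
  exact this ha

theorem gen_mul_mem {m : ℕ} {a : S} (ha : a ∈ powFiltration f x m) :
    x * a ∈ powFiltration f x (m + 1) := by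
  refine map_mem (AddMonoidHom.mulLeft x) (fun i hi b => ?_) ha
  rw [AddMonoidHom.coe_mulLeft, ← mul_assoc, ← pow_succ']
  exact pow_mul_mem (by omega) b

theorem mul_coeff_mem {m : ℕ} {a : S} (ha : a ∈ powFiltration f x m) (c : B) :
    a * f c ∈ powFiltration f x m := by
  refine map_mem (AddMonoidHom.mulRight (f c)) (fun i hi b => ?_) ha
  rw [AddMonoidHom.mulRight_apply, mul_assoc, ← map_mul]
  exact pow_mul_mem hi _

theorem exists_sub_mem {m : ℕ} {a : S} (ha : a ∈ powFiltration f x (m + 1)) :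
    ∃ b, a - x ^ m * f b ∈ powFiltration f x m := by
  induction ha using AddSubgroup.closure_induction with
  | mem a h =>
    obtain ⟨i, hi, b, rfl⟩ := h
    rcases Nat.lt_succ_iff_lt_or_eq.1 hi with h | rfl
    · exact ⟨0, by simpa using pow_mul_mem h b⟩
    · exact ⟨b, by simp [zero_mem]⟩
  | zero => exact ⟨0, by simp [zero_mem]⟩
  | add a b _ _ ha hb =>
    obtain ⟨c, hc⟩ := ha
    obtain ⟨d, hd⟩ := hb
    refine ⟨c + d, ?_⟩
    convert add_mem hc hd using 1
    rw [map_add, mul_add]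
    abel
  | neg a _ ha =>
    obtain ⟨c, hc⟩ := ha
    refine ⟨-c, ?_⟩
    convert neg_mem hc using 1
    rw [map_neg, mul_neg]
    abel

theorem coeff_mul_pow_mem (hr : ∀ b, ∃ c d, f b * x = x * f c + f d) (b : B) (i : ℕ) :
    f b * x ^ i ∈ powFiltration f x (i + 1) := by
  induction i generalizing b with
  | zero => simpa using pow_mul_mem (f := f) (x := x) zero_lt_one b
  | succ i ih =>
    obtain ⟨c, d, h⟩ := hr b
    rw [pow_succ', ← mul_assoc, h, add_mul, mul_assoc]
    exact add_mem (gen_mul_mem (ih c)) (mono (Nat.le_succ _) (ih d))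

theorem coeff_mul_mem (hr : ∀ b, ∃ c d, f b * x = x * f c + f d) {m : ℕ} {a : S}
    (ha : a ∈ powFiltration f x m) (c : B) : f c * a ∈ powFiltration f x m := by
  refine map_mem (AddMonoidHom.mulLeft (f c)) (fun i hi b => ?_) ha
  rw [AddMonoidHom.coe_mulLeft, ← mul_assoc]
  exact mul_coeff_mem (mono hi (coeff_mul_pow_mem hr c i)) b

theorem exists_pow_mul_sub_mem (hl : ∀ b, ∃ c d, x * f b = f c * x + f d)
    (hr : ∀ b, ∃ c d, f b * x = x * f c + f d) (m : ℕ) (c : B) :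
    ∃ b, x ^ m * f c - f b * x ^ m ∈ powFiltration f x m := by
  induction m with
  | zero => exact ⟨c, by simp [zero_mem]⟩
  | succ m ih =>
    obtain ⟨b, hb⟩ := ih
    obtain ⟨b', d, h⟩ := hl b
    refine ⟨b', ?_⟩
    convert add_mem (gen_mul_mem hb) (coeff_mul_pow_mem hr d m) using 1
    rw [mul_sub, ← mul_assoc x (f b), h, pow_succ', add_mul]
    simp only [mul_assoc]
    abel

theorem exists_mem (hr : ∀ b, ∃ c d, f b * x = x * f c + f d)
    (hgen : Subring.closure (insert x (Set.range f)) = ⊤) (s : S) :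
    ∃ m, s ∈ powFiltration f x m := by
  suffices h : ∀ u : S, (∃ m, u ∈ powFiltration f x m) → ∃ m, s * u ∈ powFiltration f x m by
    simpa using h 1 ⟨1, by simpa using pow_mul_mem (f := f) (x := x) zero_lt_one 1⟩
  have hs : s ∈ Subring.closure (insert x (Set.range f)) := hgen ▸ Subring.mem_top s
  induction hs using Subring.closure_induction with
  | mem a h =>
    rintro u ⟨m, hm⟩
    rcases h with rfl | ⟨b, rfl⟩
    · exact ⟨_, gen_mul_mem hm⟩
    · exact ⟨_, coeff_mul_mem hr hm b⟩
  | zero => exact fun u _ => ⟨0, by simp [zero_mem]⟩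
  | one => exact fun u h => by simpa using h
  | add a b _ _ ha hb =>
    intro u hu
    obtain ⟨m, hm⟩ := ha u hu
    obtain ⟨k, hk⟩ := hb u hu
    refine ⟨max m k, ?_⟩
    rw [add_mul]
    exact add_mem (mono (le_max_left _ _) hm) (mono (le_max_right _ _) hk)
  | neg a _ ha =>
    intro u hu
    obtain ⟨m, hm⟩ := ha u hu
    exact ⟨m, by simpa using hm⟩
  | mul a b _ _ ha hb =>
    intro u hu
    simpa only [mul_assoc] using ha _ (hb u hu)

/-- The left ideal of `B` of leading coefficients of the elements of degree at most `m` of a left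
ideal of `S`. -/
def leadingIdeal (hl : ∀ b, ∃ c d, x * f b = f c * x + f d)
    (hr : ∀ b, ∃ c d, f b * x = x * f c + f d) (m : ℕ) (I : Ideal S) : Ideal B where
  carrier := {b | ∃ a ∈ I, a - x ^ m * f b ∈ powFiltration f x m}
  zero_mem' := ⟨0, I.zero_mem, by simp [zero_mem]⟩
  add_mem' := by
    rintro b c ⟨u, hu, hb⟩ ⟨v, hv, hc⟩
    refine ⟨u + v, I.add_mem hu hv, ?_⟩
    convert add_mem hb hc using 1
    rw [map_add, mul_add]
    abel
  smul_mem' := by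
    rintro c b ⟨u, hu, hb⟩
    obtain ⟨d, hd⟩ := exists_pow_mul_sub_mem hl hr m c
    refine ⟨f d * u, I.mul_mem_left _ hu, ?_⟩
    convert sub_mem (coeff_mul_mem hr hb d) (mul_coeff_mem hd b) using 1
    rw [smul_eq_mul, map_mul, mul_sub, sub_mul]
    simp only [mul_assoc]
    abel

variable {hl : ∀ b, ∃ c d, x * f b = f c * x + f d} {hr : ∀ b, ∃ c d, f b * x = x * f c + f d}

theorem leadingIdeal_mono {m k : ℕ} (hmk : m ≤ k) {I J : Ideal S} (hIJ : I ≤ J) :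
    leadingIdeal hl hr m I ≤ leadingIdeal hl hr k J := by
  induction hmk with
  | refl => exact fun b ⟨a, ha, hb⟩ => ⟨a, hIJ ha, hb⟩
  | step _ ih =>
    intro b hb
    obtain ⟨a, ha, h⟩ := ih hb
    refine ⟨x * a, J.mul_mem_left _ ha, ?_⟩
    rw [pow_succ', mul_assoc, ← mul_sub]
    exact gen_mul_mem h

/-- A left ideal is determined, inside a larger one, by its leading coefficients. -/
theorem le_of_leadingIdeal_le (hgen : Subring.closure (insert x (Set.range f)) = ⊤)
    {I J : Ideal S} (hIJ : I ≤ J)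
    (h : ∀ m, leadingIdeal hl hr m J ≤ leadingIdeal hl hr m I) : J ≤ I := by
  suffices H : ∀ m, ∀ a ∈ J, a ∈ powFiltration f x m → a ∈ I by
    intro a ha
    obtain ⟨m, hm⟩ := exists_mem hr hgen a
    exact H m a ha hm
  intro m
  induction m with
  | zero =>
    intro a _ h0
    rw [eq_zero_of_mem_zero h0]
    exact I.zero_mem
  | succ m ih =>
    intro a ha hm
    obtain ⟨b, hb⟩ := exists_sub_mem hm
    obtain ⟨c, hc, hcb⟩ := h m ⟨a, ha, hb⟩
    have hac : a - c ∈ powFiltration f x m := by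
      convert sub_mem hb hcb using 1
      abel
    have := ih (a - c) (J.sub_mem ha (hIJ hc)) hac
    simpa using I.add_mem this hc

end powFiltration

open powFiltration in
/-- **Hilbert basis theorem** for a ring generated by a left Noetherian ring `B` and an element `x`
with `x B ⊆ B x + B` and `B x ⊆ x B + B`. -/
theorem isNoetherianRing_of_closure_insert {B S : Type*} [Ring B] [Ring S] [IsNoetherianRing B]
    (f : B →+* S) (x : S) (hl : ∀ b, ∃ c d, x * f b = f c * x + f d)
    (hr : ∀ b, ∃ c d, f b * x = x * f c + f d)
    (hgen : Subring.closure (insert x (Set.range f)) = ⊤) : IsNoetherianRing S := by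
  refine monotone_stabilizes_iff_noetherian.1 fun I => ?_
  have stab (g : ℕ →o Ideal B) : ∃ N, ∀ k, N ≤ k → g N = g k :=
    monotone_stabilizes_iff_noetherian.2 inferInstance g
  obtain ⟨N, hN⟩ := stab ⟨fun k => leadingIdeal hl hr k (I k),
    fun _ _ h => leadingIdeal_mono h (I.monotone h)⟩
  choose M hM using fun m => stab ⟨fun k => leadingIdeal hl hr m (I k),
    fun _ _ h => leadingIdeal_mono le_rfl (I.monotone h)⟩
  refine ⟨N + ∑ m ∈ Finset.range N, M m, fun k hk => le_antisymm (I.monotone hk) ?_⟩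
  refine le_of_leadingIdeal_le (hl := hl) (hr := hr) hgen (I.monotone hk) fun m => ?_
  rcases lt_or_ge m N with hm | hm
  · have hle : M m ≤ N + ∑ m ∈ Finset.range N, M m :=
      (Finset.single_le_sum (f := M) (fun _ _ => Nat.zero_le _) (Finset.mem_range.2 hm)).trans
        (Nat.le_add_left _ _)
    exact ((hM m k (hle.trans hk)).symm.trans (hM m _ hle)).le
  · calc leadingIdeal hl hr m (I k)
        ≤ leadingIdeal hl hr (max m k) (I (max m k)) :=
          leadingIdeal_mono (le_max_left _ _) (I.monotone (le_max_right _ _))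
      _ = leadingIdeal hl hr N (I N) := (hN _ (hm.trans (le_max_left _ _))).symm
      _ ≤ _ := leadingIdeal_mono hm (I.monotone (Nat.le_add_right _ _))

/-- Adjoining to a left Noetherian subalgebra `K⟨T⟩` an element `x` that commutes with each
element of `T` up to a nonzero scalar and an element of `K⟨T⟩` gives a left Noetherian
subalgebra. -/
theorem isNoetherianRing_adjoin_insert {K A : Type*} [Field K] [Ring A] [Algebra K A] {T : Set A}
    {x : A} (hT : IsNoetherianRing (Algebra.adjoin K T))
    (h : ∀ t ∈ T, ∃ c : K, c ≠ 0 ∧ ∃ d ∈ Algebra.adjoin K T, x * t = c • (t * x) + d) :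
    IsNoetherianRing (Algebra.adjoin K (insert x T)) := by
  have hle : Algebra.adjoin K T ≤ Algebra.adjoin K (insert x T) :=
    Algebra.adjoin_mono (Set.subset_insert _ _)
  have hl : ∀ b ∈ Algebra.adjoin K T, ∃ c ∈ Algebra.adjoin K T, ∃ d ∈ Algebra.adjoin K T,
      x * b = c * x + d := by
    intro b hb
    induction hb using Algebra.adjoin_induction with
    | mem t ht =>
      obtain ⟨c, -, d, hd, e⟩ := h t ht
      exact ⟨c • t, Subalgebra.smul_mem _ (Algebra.subset_adjoin ht) c, d, hd, by
        rw [e, smul_mul_assoc]⟩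
    | algebraMap c =>
      exact ⟨_, Subalgebra.algebraMap_mem _ c, 0, zero_mem _, by
        rw [add_zero, Algebra.commutes]⟩
    | add a b _ _ ha hb =>
      obtain ⟨c, hc, d, hd, e⟩ := ha
      obtain ⟨c', hc', d', hd', e'⟩ := hb
      exact ⟨_, add_mem hc hc', _, add_mem hd hd', by rw [mul_add, e, e', add_mul]; abel⟩
    | mul a b _ hbT ha hb =>
      obtain ⟨c, hc, d, hd, e⟩ := ha
      obtain ⟨c', hc', d', hd', e'⟩ := hb
      refine ⟨_, mul_mem hc hc', _, add_mem (mul_mem hc hd') (mul_mem hd hbT), ?_⟩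
      rw [← mul_assoc, e, add_mul, mul_assoc c, e', mul_add, mul_assoc, add_assoc]
  have hr : ∀ b ∈ Algebra.adjoin K T, ∃ c ∈ Algebra.adjoin K T, ∃ d ∈ Algebra.adjoin K T,
      b * x = x * c + d := by
    intro b hb
    induction hb using Algebra.adjoin_induction with
    | mem t ht =>
      obtain ⟨c, hc, d, hd, e⟩ := h t ht
      refine ⟨c⁻¹ • t, Subalgebra.smul_mem _ (Algebra.subset_adjoin ht) _, -(c⁻¹ • d),
        neg_mem (Subalgebra.smul_mem _ hd _), ?_⟩
      rw [mul_smul_comm, e, smul_add, inv_smul_smul₀ hc]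
      abel
    | algebraMap c =>
      exact ⟨_, Subalgebra.algebraMap_mem _ c, 0, zero_mem _, by
        rw [add_zero, Algebra.commutes]⟩
    | add a b _ _ ha hb =>
      obtain ⟨c, hc, d, hd, e⟩ := ha
      obtain ⟨c', hc', d', hd', e'⟩ := hb
      exact ⟨_, add_mem hc hc', _, add_mem hd hd', by rw [add_mul, e, e', mul_add]; abel⟩
    | mul a b haT _ ha hb =>
      obtain ⟨c, hc, d, hd, e⟩ := ha
      obtain ⟨c', hc', d', hd', e'⟩ := hb
      refine ⟨_, mul_mem hc hc', _, add_mem (mul_mem hd hc') (mul_mem haT hd'), ?_⟩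
      rw [mul_assoc, e', mul_add, ← mul_assoc, e, add_mul, mul_assoc, add_assoc]
  refine isNoetherianRing_of_closure_insert (Subalgebra.inclusion hle).toRingHom
    ⟨x, Algebra.subset_adjoin (Set.mem_insert _ _)⟩ ?_ ?_ ?_
  · rintro ⟨b, hb⟩
    obtain ⟨c, hc, d, hd, e⟩ := hl b hb
    exact ⟨⟨c, hc⟩, ⟨d, hd⟩, Subtype.ext e⟩
  · rintro ⟨b, hb⟩
    obtain ⟨c, hc, d, hd, e⟩ := hr b hb
    exact ⟨⟨c, hc⟩, ⟨d, hd⟩, Subtype.ext e⟩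
  · refine eq_top_iff.2 ?_
    rintro ⟨a, ha⟩ -
    induction ha using Algebra.adjoin_induction with
    | mem t ht =>
      rcases ht with rfl | ht
      · exact Subring.subset_closure (Set.mem_insert _ _)
      · exact Subring.subset_closure (Set.mem_insert_of_mem _
          ⟨⟨t, Algebra.subset_adjoin ht⟩, rfl⟩)
    | algebraMap c =>
      exact Subring.subset_closure (Set.mem_insert_of_mem _
        ⟨⟨algebraMap K A c, Subalgebra.algebraMap_mem _ c⟩, rfl⟩)
    | add a b _ _ ha hb => exact add_mem ha hb
    | mul a b _ _ ha hb => exact mul_mem ha hb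

section Presentation

variable {K : Type} [Field K] {n : ℕ} {r s : Fin n → K}

/-- The image of a generator in the multiparameter Weyl algebra. -/
noncomputable def gen (r s : Fin n → K) (g : WGen n) : MWA K n r s :=
  RingQuot.mkAlgHom K (WRel K n r s) (gi K n g)

theorem mk_eq_of_rel {a b : FreeAlgebra K (WGen n)} (h : WRel K n r s a b) :
    RingQuot.mkAlgHom K (WRel K n r s) a = RingQuot.mkAlgHom K (WRel K n r s) b :=
  RingQuot.mkAlgHom_rel K h

theorem adjoin_range_gen : Algebra.adjoin K (Set.range (gen r s)) = ⊤ := by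
  have h := congrArg (Subalgebra.map (RingQuot.mkAlgHom K (WRel K n r s)))
    (FreeAlgebra.adjoin_range_ι (R := K) (X := WGen n))
  rw [AlgHom.map_adjoin, Algebra.map_top, (AlgHom.range_eq_top _).2
    (RingQuot.mkAlgHom_surjective K _), ← Set.range_comp] at h
  exact h

theorem gen_tor_mul (p q : Fin n × Fin 4) :
    gen r s (tor n p) * gen r s (tor n q) = gen r s (tor n q) * gen r s (tor n p) := by
  simpa [gen] using mk_eq_of_rel (WRel.torComm (r := r) (s := s) p q)

theorem rho_mul_rhoInv (i : Fin n) : gen r s (.rho i) * gen r s (.rhoInv i) = 1 := by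
  simpa [gen] using mk_eq_of_rel (WRel.rhoUnit (r := r) (s := s) i)

theorem rhoInv_mul_rho (i : Fin n) : gen r s (.rhoInv i) * gen r s (.rho i) = 1 := by
  simpa [gen] using mk_eq_of_rel (WRel.rhoUnit' (r := r) (s := s) i)

theorem sg_mul_sgInv (i : Fin n) : gen r s (.sg i) * gen r s (.sgInv i) = 1 := by
  simpa [gen] using mk_eq_of_rel (WRel.sgUnit (r := r) (s := s) i)

theorem sgInv_mul_sg (i : Fin n) : gen r s (.sgInv i) * gen r s (.sg i) = 1 := by
  simpa [gen] using mk_eq_of_rel (WRel.sgUnit' (r := r) (s := s) i)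

theorem rho_mul_x (i j : Fin n) : gen r s (.rho i) * gen r s (.x j) =
    (if i = j then r i else 1) • (gen r s (.x j) * gen r s (.rho i)) := by
  simpa only [gen, map_mul, map_smul] using mk_eq_of_rel (WRel.rhoX (r := r) (s := s) i j)

theorem rho_mul_y (i j : Fin n) : gen r s (.rho i) * gen r s (.y j) =
    (if i = j then (r i)⁻¹ else 1) • (gen r s (.y j) * gen r s (.rho i)) := by
  simpa only [gen, map_mul, map_smul] using mk_eq_of_rel (WRel.rhoY (r := r) (s := s) i j)

theorem sg_mul_x (i j : Fin n) : gen r s (.sg i) * gen r s (.x j) =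
    (if i = j then s i else 1) • (gen r s (.x j) * gen r s (.sg i)) := by
  simpa only [gen, map_mul, map_smul] using mk_eq_of_rel (WRel.sgX (r := r) (s := s) i j)

theorem sg_mul_y (i j : Fin n) : gen r s (.sg i) * gen r s (.y j) =
    (if i = j then (s i)⁻¹ else 1) • (gen r s (.y j) * gen r s (.sg i)) := by
  simpa only [gen, map_mul, map_smul] using mk_eq_of_rel (WRel.sgY (r := r) (s := s) i j)

theorem x_mul_x (i j : Fin n) :
    gen r s (.x i) * gen r s (.x j) = gen r s (.x j) * gen r s (.x i) := by
  simpa [gen] using mk_eq_of_rel (WRel.xComm (r := r) (s := s) i j)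

theorem y_mul_y (i j : Fin n) :
    gen r s (.y i) * gen r s (.y j) = gen r s (.y j) * gen r s (.y i) := by
  simpa [gen] using mk_eq_of_rel (WRel.yComm (r := r) (s := s) i j)

theorem y_mul_x_of_ne {i j : Fin n} (h : i ≠ j) :
    gen r s (.y i) * gen r s (.x j) = gen r s (.x j) * gen r s (.y i) := by
  simpa [gen] using mk_eq_of_rel (WRel.yxComm (r := r) (s := s) i j h)

theorem weyl_r (i : Fin n) :
    gen r s (.y i) * gen r s (.x i) - r i ^ 2 • (gen r s (.x i) * gen r s (.y i)) =
      gen r s (.sg i) * gen r s (.sg i) := by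
  simpa only [gen, map_mul, map_smul, map_sub] using mk_eq_of_rel (WRel.weylR (r := r) (s := s) i)

theorem weyl_s (i : Fin n) :
    gen r s (.y i) * gen r s (.x i) - s i ^ 2 • (gen r s (.x i) * gen r s (.y i)) =
      gen r s (.rho i) * gen r s (.rho i) := by
  simpa only [gen, map_mul, map_smul, map_sub] using mk_eq_of_rel (WRel.weylS (r := r) (s := s) i)

/-- The subalgebra generated by the `ρ_i^{±1}` and `σ_i^{±1}`. -/
noncomputable def torusSubalgebra (r s : Fin n → K) : Subalgebra K (MWA K n r s) :=
  Algebra.adjoin K (Set.range fun p => gen r s (tor n p))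

theorem gen_tor_mem (p : Fin n × Fin 4) : gen r s (tor n p) ∈ torusSubalgebra r s :=
  Algebra.subset_adjoin ⟨p, rfl⟩

theorem rho_mem (i : Fin n) : gen r s (.rho i) ∈ torusSubalgebra r s := gen_tor_mem (i, 0)

theorem sg_mem (i : Fin n) : gen r s (.sg i) ∈ torusSubalgebra r s := gen_tor_mem (i, 2)

theorem mem_of_sub_smul_mem {A : Type*} [Ring A] [Algebra K A] {C : Subalgebra K A} {a b : A}
    {c d : K} (h : d - c ≠ 0) (hc : a - c • b ∈ C) (hd : a - d • b ∈ C) : b ∈ C := by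
  have hb : (d - c) • b = (a - c • b) - (a - d • b) := by
    rw [sub_smul]
    abel
  rw [← inv_smul_smul₀ h b, hb]
  exact C.smul_mem (sub_mem hc hd) _

theorem x_mul_y_mem {i : Fin n} (hi : s i ^ 2 - r i ^ 2 ≠ 0) :
    gen r s (.x i) * gen r s (.y i) ∈ torusSubalgebra r s := by
  refine mem_of_sub_smul_mem (a := gen r s (.y i) * gen r s (.x i)) hi ?_ ?_
  · rw [weyl_r]
    exact mul_mem (sg_mem i) (sg_mem i)
  · rw [weyl_s]
    exact mul_mem (rho_mem i) (rho_mem i)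

theorem y_mul_x_mem {i : Fin n} (hi : s i ^ 2 - r i ^ 2 ≠ 0) :
    gen r s (.y i) * gen r s (.x i) ∈ torusSubalgebra r s := by
  rw [← sub_add_cancel (gen r s (.y i) * gen r s (.x i))
    (r i ^ 2 • (gen r s (.x i) * gen r s (.y i))), weyl_r]
  exact add_mem (mul_mem (sg_mem i) (sg_mem i)) (Subalgebra.smul_mem _ (x_mul_y_mem hi) _)

theorem inv_quasi_commute {A : Type*} [Ring A] [Algebra K A] {u v a : A} {c : K}
    (huv : u * v = 1) (hvu : v * u = 1) (hc : c ≠ 0) (h : u * a = c • (a * u)) :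
    v * a = c⁻¹ • (a * v) := by
  have : a * v = c • (v * a) := by
    calc a * v = v * u * (a * v) := by rw [hvu, one_mul]
      _ = v * (u * a) * v := by simp only [mul_assoc]
      _ = c • (v * a * (u * v)) := by
        rw [h, mul_smul_comm, smul_mul_assoc]
        simp only [mul_assoc]
      _ = c • (v * a) := by rw [huv, mul_one]
  rw [this, inv_smul_smul₀ hc]

/-- The torus generators commute with the `x_j` and `y_j` up to nonzero scalars. -/
theorem exists_gen_tor_mul (hr : ∀ i, r i ≠ 0) (hs : ∀ i, s i ≠ 0) (p : Fin n × Fin 4)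
    (w : WGen n) :
    ∃ c : K, c ≠ 0 ∧ gen r s (tor n p) * gen r s w = c • (gen r s w * gen r s (tor n p)) := by
  have hite (P : Prop) [Decidable P] {c : K} (hc : c ≠ 0) : (if P then c else 1) ≠ 0 := by
    split_ifs
    exacts [hc, one_ne_zero]
  have key (q : Fin n × Fin 4) : ∃ c : K, c ≠ 0 ∧
      gen r s (tor n p) * gen r s (tor n q) = c • (gen r s (tor n q) * gen r s (tor n p)) :=
    ⟨1, one_ne_zero, by rw [one_smul, gen_tor_mul]⟩
  obtain ⟨i, t⟩ := p
  cases w with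
  | rho j => exact key (j, 0)
  | rhoInv j => exact key (j, 1)
  | sg j => exact key (j, 2)
  | sgInv j => exact key (j, 3)
  | x j =>
    fin_cases t
    · exact ⟨_, hite _ (hr i), rho_mul_x i j⟩
    · exact ⟨_, inv_ne_zero (hite _ (hr i)),
        inv_quasi_commute (rho_mul_rhoInv i) (rhoInv_mul_rho i) (hite _ (hr i)) (rho_mul_x i j)⟩
    · exact ⟨_, hite _ (hs i), sg_mul_x i j⟩
    · exact ⟨_, inv_ne_zero (hite _ (hs i)),
        inv_quasi_commute (sg_mul_sgInv i) (sgInv_mul_sg i) (hite _ (hs i)) (sg_mul_x i j)⟩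
  | y j =>
    have hr' := inv_ne_zero (hr i)
    have hs' := inv_ne_zero (hs i)
    fin_cases t
    · exact ⟨_, hite _ hr', rho_mul_y i j⟩
    · exact ⟨_, inv_ne_zero (hite _ hr'),
        inv_quasi_commute (rho_mul_rhoInv i) (rhoInv_mul_rho i) (hite _ hr') (rho_mul_y i j)⟩
    · exact ⟨_, hite _ hs', sg_mul_y i j⟩
    · exact ⟨_, inv_ne_zero (hite _ hs'),
        inv_quasi_commute (sg_mul_sgInv i) (sgInv_mul_sg i) (hite _ hs') (sg_mul_y i j)⟩

theorem exists_mul_gen_tor (hr : ∀ i, r i ≠ 0) (hs : ∀ i, s i ≠ 0) (p : Fin n × Fin 4)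
    (w : WGen n) :
    ∃ c : K, c ≠ 0 ∧ gen r s w * gen r s (tor n p) = c • (gen r s (tor n p) * gen r s w) := by
  obtain ⟨c, hc, h⟩ := exists_gen_tor_mul hr hs p w
  exact ⟨c⁻¹, inv_ne_zero hc, by rw [h, inv_smul_smul₀ hc]⟩

theorem wgen_cases (w : WGen n) :
    (∃ p, w = tor n p) ∨ (∃ i, w = .x i) ∨ ∃ i, w = .y i := by
  cases w with
  | rho i => exact .inl ⟨(i, 0), rfl⟩
  | rhoInv i => exact .inl ⟨(i, 1), rfl⟩
  | sg i => exact .inl ⟨(i, 2), rfl⟩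
  | sgInv i => exact .inl ⟨(i, 3), rfl⟩
  | x i => exact .inr (.inl ⟨i, rfl⟩)
  | y i => exact .inr (.inr ⟨i, rfl⟩)

/-- Any two generators commute up to a nonzero scalar and an element of the torus subalgebra. -/
theorem exists_gen_mul_gen (hr : ∀ i, r i ≠ 0) (hs : ∀ i, s i ≠ 0)
    (hd : ∀ i, s i ^ 2 - r i ^ 2 ≠ 0) (v w : WGen n) :
    ∃ c : K, c ≠ 0 ∧ ∃ d ∈ torusSubalgebra r s,
      gen r s v * gen r s w = c • (gen r s w * gen r s v) + d := by
  have comm {v w : WGen n} (h : gen r s v * gen r s w = gen r s w * gen r s v) :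
      ∃ c : K, c ≠ 0 ∧ ∃ d ∈ torusSubalgebra r s,
        gen r s v * gen r s w = c • (gen r s w * gen r s v) + d :=
    ⟨1, one_ne_zero, 0, zero_mem _, by rw [h, one_smul, add_zero]⟩
  have mem {v w : WGen n} (h : gen r s v * gen r s w ∈ torusSubalgebra r s)
      (h' : gen r s w * gen r s v ∈ torusSubalgebra r s) :
      ∃ c : K, c ≠ 0 ∧ ∃ d ∈ torusSubalgebra r s,
        gen r s v * gen r s w = c • (gen r s w * gen r s v) + d :=
    ⟨1, one_ne_zero, _, sub_mem h h', by rw [one_smul]; abel⟩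
  rcases wgen_cases v with ⟨p, rfl⟩ | hv
  · obtain ⟨c, hc, h⟩ := exists_gen_tor_mul hr hs p w
    exact ⟨c, hc, 0, zero_mem _, by rw [h, add_zero]⟩
  rcases wgen_cases w with ⟨p, rfl⟩ | hw
  · obtain ⟨c, hc, h⟩ := exists_mul_gen_tor hr hs p v
    exact ⟨c, hc, 0, zero_mem _, by rw [h, add_zero]⟩
  rcases hv with ⟨i, rfl⟩ | ⟨i, rfl⟩ <;> rcases hw with ⟨j, rfl⟩ | ⟨j, rfl⟩
  · exact comm (x_mul_x i j)
  · rcases eq_or_ne j i with rfl | h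
    · exact mem (x_mul_y_mem (hd j)) (y_mul_x_mem (hd j))
    · exact comm (y_mul_x_of_ne h).symm
  · rcases eq_or_ne i j with rfl | h
    · exact mem (y_mul_x_mem (hd i)) (x_mul_y_mem (hd i))
    · exact comm (y_mul_x_of_ne h)
  · exact comm (y_mul_y i j)

instance : Finite (WGen n) :=
  Finite.of_surjective
    (Sum.elim (tor n) (Sum.elim WGen.x WGen.y) : (Fin n × Fin 4) ⊕ (Fin n ⊕ Fin n) → WGen n) <| by
    intro w
    rcases wgen_cases w with ⟨p, rfl⟩ | ⟨i, rfl⟩ | ⟨i, rfl⟩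
    exacts [⟨.inl p, rfl⟩, ⟨.inr (.inl i), rfl⟩, ⟨.inr (.inr i), rfl⟩]

theorem isNoetherianRing_torusSubalgebra : IsNoetherianRing (torusSubalgebra r s) := by
  classical
  refine Set.Finite.induction_on_subset
    (motive := fun T _ => IsNoetherianRing (Algebra.adjoin K T)) _
    (Set.finite_range fun p => gen r s (tor n p)) ?_ ?_
  · rw [Algebra.adjoin_empty]
    exact isNoetherianRing_of_surjective K _ (Algebra.ofId K _).toRingHom
      fun ⟨_, c, hc⟩ => ⟨c, Subtype.ext hc⟩
  · rintro _ T ⟨p, rfl⟩ hT _ ih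
    refine isNoetherianRing_adjoin_insert ih fun t ht => ?_
    obtain ⟨q, rfl⟩ := hT ht
    exact ⟨1, one_ne_zero, 0, zero_mem _, by rw [one_smul, add_zero, gen_tor_mul]⟩

/-- The multiparameter Weyl algebra is left Noetherian. -/
theorem isNoetherianRing_mwa (hr : ∀ i, r i ≠ 0) (hs : ∀ i, s i ≠ 0)
    (hd : ∀ i, s i ^ 2 - r i ^ 2 ≠ 0) : IsNoetherianRing (MWA K n r s) := by
  have h := Set.Finite.induction_on_subset
    (motive := fun T _ => IsNoetherianRing
      (Algebra.adjoin K (T ∪ Set.range fun p => gen r s (tor n p)))) _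
    (Set.finite_range (gen r s)) (by
      rw [Set.empty_union]
      exact isNoetherianRing_torusSubalgebra) (by
      rintro _ T ⟨v, rfl⟩ hT _ ih
      rw [Set.insert_union]
      refine isNoetherianRing_adjoin_insert ih ?_
      have hgen (t) (ht : t ∈ T ∪ Set.range fun p => gen r s (tor n p)) : ∃ w, t = gen r s w := by
        rcases ht with ht | ⟨p, rfl⟩
        · obtain ⟨w, rfl⟩ := hT ht
          exact ⟨w, rfl⟩
        · exact ⟨_, rfl⟩
      intro t ht
      obtain ⟨w, rfl⟩ := hgen t ht
      obtain ⟨c, hc, d, hdT, h⟩ := exists_gen_mul_gen hr hs hd v w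
      exact ⟨c, hc, d, Algebra.adjoin_mono Set.subset_union_right hdT, h⟩)
  have htop : Algebra.adjoin K (Set.range (gen r s) ∪ Set.range fun p => gen r s (tor n p)) = ⊤ :=
    eq_top_iff.2 (adjoin_range_gen.ge.trans (Algebra.adjoin_mono Set.subset_union_left))
  rw [htop] at h
  exact isNoetherianRing_of_surjective _ _ (Subalgebra.topEquiv (R := K)).toRingEquiv.toRingHom
    (Subalgebra.topEquiv (R := K)).surjective

/-- The involution of the generators that exchanges `x_i` and `y_i`. -/
def swapXY : WGen n → WGen n
  | .x i => .y i
  | .y i => .x i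
  | w => w

/-- The anti-involution of the multiparameter Weyl algebra that exchanges `x_i` and `y_i` and fixes
the torus generators. -/
noncomputable def antiInvolution (hr : ∀ i, r i ≠ 0) (hs : ∀ i, s i ≠ 0) :
    MWA K n r s →ₐ[K] (MWA K n r s)ᵐᵒᵖ :=
  RingQuot.liftAlgHom K ⟨FreeAlgebra.lift K fun w => MulOpposite.op (gen r s (swapXY w)), by
    have htor (p : Fin n × Fin 4) : swapXY (tor n p) = tor n p := by
      obtain ⟨i, t⟩ := p
      fin_cases t <;> rfl
    have hite (i j : Fin n) (c : K) :
        (if i = j then c⁻¹ else 1) = (if i = j then c else 1)⁻¹ := by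
      split_ifs <;> simp
    have hne (i j : Fin n) {c : K} (hc : c ≠ 0) : (if i = j then c else 1) ≠ 0 := by
      split_ifs
      exacts [hc, one_ne_zero]
    intro a b h
    induction h with
    | torComm p q =>
      simp only [gi, map_mul, FreeAlgebra.lift_ι_apply, htor, ← MulOpposite.op_mul, gen_tor_mul p q]
    | rhoUnit i => simp [gi, swapXY, ← MulOpposite.op_mul, rhoInv_mul_rho]
    | rhoUnit' i => simp [gi, swapXY, ← MulOpposite.op_mul, rho_mul_rhoInv]
    | sgUnit i => simp [gi, swapXY, ← MulOpposite.op_mul, sgInv_mul_sg]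
    | sgUnit' i => simp [gi, swapXY, ← MulOpposite.op_mul, sg_mul_sgInv]
    | rhoX i j =>
      simp only [gi, map_mul, map_smul, FreeAlgebra.lift_ι_apply, swapXY, ← MulOpposite.op_mul,
        ← MulOpposite.op_smul, rho_mul_y, hite, smul_inv_smul₀ (hne i j (hr i))]
    | rhoY i j =>
      simp only [gi, map_mul, map_smul, FreeAlgebra.lift_ι_apply, swapXY, ← MulOpposite.op_mul,
        ← MulOpposite.op_smul, rho_mul_x, hite, inv_smul_smul₀ (hne i j (hr i))]
    | sgX i j =>
      simp only [gi, map_mul, map_smul, FreeAlgebra.lift_ι_apply, swapXY, ← MulOpposite.op_mul,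
        ← MulOpposite.op_smul, sg_mul_y, hite, smul_inv_smul₀ (hne i j (hs i))]
    | sgY i j =>
      simp only [gi, map_mul, map_smul, FreeAlgebra.lift_ι_apply, swapXY, ← MulOpposite.op_mul,
        ← MulOpposite.op_smul, sg_mul_x, hite, inv_smul_smul₀ (hne i j (hs i))]
    | xComm i j =>
      simp only [gi, map_mul, FreeAlgebra.lift_ι_apply, swapXY, ← MulOpposite.op_mul, y_mul_y i j]
    | yComm i j =>
      simp only [gi, map_mul, FreeAlgebra.lift_ι_apply, swapXY, ← MulOpposite.op_mul, x_mul_x i j]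
    | yxComm i j h =>
      simp only [gi, map_mul, FreeAlgebra.lift_ι_apply, swapXY, ← MulOpposite.op_mul,
        y_mul_x_of_ne h.symm]
    | weylR i =>
      simp only [gi, map_mul, map_sub, map_smul, FreeAlgebra.lift_ι_apply, swapXY,
        ← MulOpposite.op_mul, ← MulOpposite.op_smul, ← MulOpposite.op_sub, weyl_r]
    | weylS i =>
      simp only [gi, map_mul, map_sub, map_smul, FreeAlgebra.lift_ι_apply, swapXY,
        ← MulOpposite.op_mul, ← MulOpposite.op_smul, ← MulOpposite.op_sub, weyl_s]⟩

theorem antiInvolution_gen (hr : ∀ i, r i ≠ 0) (hs : ∀ i, s i ≠ 0) (w : WGen n) :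
    antiInvolution hr hs (gen r s w) = MulOpposite.op (gen r s (swapXY w)) := by
  simp [antiInvolution, gen, gi]

theorem antiInvolution_surjective (hr : ∀ i, r i ≠ 0) (hs : ∀ i, s i ≠ 0) :
    Function.Surjective (antiInvolution hr hs) := by
  intro a
  induction a using MulOpposite.rec' with | _ a =>
  have ha : a ∈ Algebra.adjoin K (Set.range (gen r s)) := by
    rw [adjoin_range_gen]
    exact Algebra.mem_top
  change MulOpposite.op a ∈ (antiInvolution hr hs).range
  induction ha using Algebra.adjoin_induction with
  | mem t ht =>
    obtain ⟨w, rfl⟩ := ht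
    refine ⟨gen r s (swapXY w), ?_⟩
    change antiInvolution hr hs _ = _
    rw [antiInvolution_gen]
    cases w <;> rfl
  | algebraMap c => exact Subalgebra.algebraMap_mem _ c
  | add a b _ _ ha hb => exact add_mem ha hb
  | mul a b _ _ ha hb => exact mul_mem hb ha

end Presentation

section SkewDomain

theorem noZeroDivisors_skewMonoidAlgebra {R G : Type*} [Ring R] [NoZeroDivisors R] [Group G]
    [UniqueProds G] [MulSemiringAction G R] : NoZeroDivisors (SkewMonoidAlgebra R G) where
  eq_zero_or_eq_zero_of_mul_eq_zero {f g} hfg := by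
    classical
    contrapose! hfg
    have hf : f.support.Nonempty := by
      rw [Finset.nonempty_iff_ne_empty, Ne, SkewMonoidAlgebra.support_eq_empty]
      exact hfg.1
    have hg : g.support.Nonempty := by
      rw [Finset.nonempty_iff_ne_empty, Ne, SkewMonoidAlgebra.support_eq_empty]
      exact hfg.2
    obtain ⟨a, ha, b, hb, h⟩ := UniqueProds.uniqueMul_of_nonempty hf hg
    have hcoeff : (f * g).coeff (a * b) = f.coeff a * a • g.coeff b := by
      rw [SkewMonoidAlgebra.coeff_mul]
      simp_rw [SkewMonoidAlgebra.sum_def', ← Finset.sum_product']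
      refine (Finset.sum_eq_single (a, b) ?_ ?_).trans (if_pos rfl)
      · intro p hp hne
        rw [Finset.mem_product] at hp
        exact if_neg fun he => hne (Prod.ext (h hp.1 hp.2 he).1 (h hp.1 hp.2 he).2)
      · exact fun hp => absurd (Finset.mem_product.2 ⟨ha, hb⟩) hp
    intro h0
    rw [h0, SkewMonoidAlgebra.coeff_zero, Finsupp.zero_apply] at hcoeff
    refine mul_ne_zero (SkewMonoidAlgebra.mem_support_iff.1 ha) ?_ hcoeff.symm
    exact (smul_ne_zero_iff_ne a).2 (SkewMonoidAlgebra.mem_support_iff.1 hb)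

end SkewDomain

section Representation

open SkewMonoidAlgebra

variable {K : Type} [Field K] {n : ℕ} {r s : Fin n → K}

/-- The `j`-th standard generator of the free abelian group `ℤ ^ n`. -/
abbrev basisElt (j : Fin n) : Fin n → Multiplicative ℤ := Pi.mulSingle j (Multiplicative.ofAdd 1)

variable {R : Type} [CommRing R] [Algebra K R] [MulSemiringAction (Fin n → Multiplicative ℤ) R]

/-- Units `ρ_i`, `σ_i` of `R` on which the group `ℤ ^ n` acts by the scalars prescribed by the
relations of the multiparameter Weyl algebra. -/
structure IsTorusAction (r s : Fin n → K) (ρ σ : Fin n → Rˣ) : Prop where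
  smul_rho (i j : Fin n) : basisElt j • (ρ i : R) = (if i = j then (r i)⁻¹ else 1) • (ρ i : R)
  smul_sg (i j : Fin n) : basisElt j • (σ i : R) = (if i = j then (s i)⁻¹ else 1) • (σ i : R)

/-- The coefficient `y_i x_i`, as an element of the torus. -/
noncomputable def yxCoeff (r s : Fin n → K) (ρ σ : Fin n → Rˣ) (i : Fin n) : R :=
  (s i ^ 2 - r i ^ 2)⁻¹ • (s i ^ 2 • (σ i : R) ^ 2 - r i ^ 2 • (ρ i : R) ^ 2)

variable [SMulCommClass (Fin n → Multiplicative ℤ) K R] {ρ σ : Fin n → Rˣ}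

namespace IsTorusAction

theorem inv_smul_of_smul {g : Fin n → Multiplicative ℤ} {a : R} {c : K} (hc : c ≠ 0)
    (h : g • a = c • a) : g⁻¹ • a = c⁻¹ • a := by
  rw [inv_smul_eq_iff, smul_comm, h, inv_smul_smul₀ hc]

theorem inv_smul_rho (h : IsTorusAction r s ρ σ) (hr : ∀ i, r i ≠ 0) (i j : Fin n) :
    (basisElt j)⁻¹ • (ρ i : R) = (if i = j then r i else 1) • (ρ i : R) := by
  rw [inv_smul_of_smul _ (h.smul_rho i j)]
  · split_ifs <;> simp
  · split_ifs
    exacts [inv_ne_zero (hr i), one_ne_zero]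

theorem inv_smul_sg (h : IsTorusAction r s ρ σ) (hs : ∀ i, s i ≠ 0) (i j : Fin n) :
    (basisElt j)⁻¹ • (σ i : R) = (if i = j then s i else 1) • (σ i : R) := by
  rw [inv_smul_of_smul _ (h.smul_sg i j)]
  · split_ifs <;> simp
  · split_ifs
    exacts [inv_ne_zero (hs i), one_ne_zero]

theorem smul_yxCoeff_of_ne (h : IsTorusAction r s ρ σ) {i j : Fin n} (hij : i ≠ j) :
    basisElt j • yxCoeff r s ρ σ i = yxCoeff r s ρ σ i := by
  simp only [yxCoeff, smul_comm (basisElt j), smul_sub, smul_pow', h.smul_rho, h.smul_sg,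
    if_neg hij, one_smul]

theorem inv_smul_yxCoeff_of_ne (h : IsTorusAction r s ρ σ) {i j : Fin n} (hij : i ≠ j) :
    (basisElt j)⁻¹ • yxCoeff r s ρ σ i = yxCoeff r s ρ σ i := by
  rw [inv_smul_eq_iff, h.smul_yxCoeff_of_ne hij]

theorem smul_yxCoeff (h : IsTorusAction r s ρ σ) (hr : ∀ i, r i ≠ 0) (hs : ∀ i, s i ≠ 0)
    (i : Fin n) : basisElt i • yxCoeff r s ρ σ i =
      (s i ^ 2 - r i ^ 2)⁻¹ • ((σ i : R) ^ 2 - (ρ i : R) ^ 2) := by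
  simp only [yxCoeff, smul_comm (basisElt i), smul_sub, smul_pow', h.smul_rho, h.smul_sg,
    if_true, smul_pow, inv_pow, smul_inv_smul₀ (pow_ne_zero 2 (hr i)),
    smul_inv_smul₀ (pow_ne_zero 2 (hs i))]

end IsTorusAction

/-- The image of a generator in the skew group algebra: `x_i` becomes a group element and `y_i`
a multiple of its inverse. -/
noncomputable def skewGen (r s : Fin n → K) (ρ σ : Fin n → Rˣ) :
    WGen n → SkewMonoidAlgebra R (Fin n → Multiplicative ℤ)
  | .rho i => single 1 (ρ i : R)
  | .rhoInv i => single 1 (↑(ρ i)⁻¹ : R)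
  | .sg i => single 1 (σ i : R)
  | .sgInv i => single 1 (↑(σ i)⁻¹ : R)
  | .x i => single (basisElt i) 1
  | .y i => single (basisElt i)⁻¹ (yxCoeff r s ρ σ i)

/-- The homomorphism from the multiparameter Weyl algebra to the skew group algebra of `ℤ ^ n` over
the torus. -/
noncomputable def toSkew (h : IsTorusAction r s ρ σ) (hr : ∀ i, r i ≠ 0) (hs : ∀ i, s i ≠ 0)
    (hd : ∀ i, s i ^ 2 - r i ^ 2 ≠ 0) :
    MWA K n r s →ₐ[K] SkewMonoidAlgebra R (Fin n → Multiplicative ℤ) :=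
  RingQuot.liftAlgHom K ⟨FreeAlgebra.lift K (skewGen r s ρ σ), by
    have htor (p : Fin n × Fin 4) : ∃ a : R, skewGen r s ρ σ (tor n p) = single 1 a := by
      obtain ⟨i, t⟩ := p
      fin_cases t <;> exact ⟨_, rfl⟩
    have hinv (i j : Fin n) {c : K} (hc : c ≠ 0) (a : R) :
        (if i = j then c else 1) • (if i = j then c⁻¹ else 1) • a = a := by
      split_ifs <;> simp [hc]
    have hinv' (i j : Fin n) {c : K} (hc : c ≠ 0) (a : R) :
        (if i = j then c⁻¹ else 1) • (if i = j then c else 1) • a = a := by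
      split_ifs <;> simp [hc]
    have hweyl (i : Fin n) (c : K) (a : R)
        (ha : yxCoeff r s ρ σ i - c • basisElt i • yxCoeff r s ρ σ i = a ^ 2) :
        skewGen r s ρ σ (.y i) * skewGen r s ρ σ (.x i) -
          c • (skewGen r s ρ σ (.x i) * skewGen r s ρ σ (.y i)) = single 1 a * single 1 a := by
      simp only [skewGen, single_mul_single, smul_one, mul_one, one_mul, inv_mul_cancel,
        mul_inv_cancel, one_smul, smul_single]
      rw [← pow_two, ← ha, sub_eq_add_neg, sub_eq_add_neg, single_add, single_neg]
    intro a b hab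
    induction hab with
    | torComm p q =>
      obtain ⟨a, ha⟩ := htor p
      obtain ⟨b, hb⟩ := htor q
      simp only [gi, map_mul, FreeAlgebra.lift_ι_apply, ha, hb, single_mul_single, one_smul,
        mul_comm a b]
    | rhoUnit i => simp [gi, skewGen]
    | rhoUnit' i => simp [gi, skewGen]
    | sgUnit i => simp [gi, skewGen]
    | sgUnit' i => simp [gi, skewGen]
    | rhoX i j =>
      simp only [gi, map_mul, map_smul, FreeAlgebra.lift_ι_apply, skewGen, single_mul_single,
        one_smul, one_mul, mul_one, smul_single, h.smul_rho, hinv i j (hr i)]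
    | rhoY i j =>
      simp only [gi, map_mul, map_smul, FreeAlgebra.lift_ι_apply, skewGen, single_mul_single,
        one_smul, mul_one, smul_single, h.inv_smul_rho hr, mul_smul_comm, hinv' i j (hr i),
        mul_comm]
    | sgX i j =>
      simp only [gi, map_mul, map_smul, FreeAlgebra.lift_ι_apply, skewGen, single_mul_single,
        one_smul, one_mul, mul_one, smul_single, h.smul_sg, hinv i j (hs i)]
    | sgY i j =>
      simp only [gi, map_mul, map_smul, FreeAlgebra.lift_ι_apply, skewGen, single_mul_single,
        one_smul, mul_one, smul_single, h.inv_smul_sg hs, mul_smul_comm, hinv' i j (hs i),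
        mul_comm]
    | xComm i j =>
      simp only [gi, map_mul, FreeAlgebra.lift_ι_apply, skewGen, single_mul_single, smul_one,
        mul_comm]
    | yComm i j =>
      rcases eq_or_ne i j with rfl | hij
      · rfl
      · simp only [gi, map_mul, FreeAlgebra.lift_ι_apply, skewGen, single_mul_single,
          h.inv_smul_yxCoeff_of_ne hij, h.inv_smul_yxCoeff_of_ne hij.symm, mul_comm]
    | yxComm i j hij =>
      simp only [gi, map_mul, FreeAlgebra.lift_ι_apply, skewGen, single_mul_single, smul_one,
        mul_one, h.smul_yxCoeff_of_ne hij, mul_comm]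
    | weylR i =>
      simp only [gi, map_mul, map_sub, map_smul, FreeAlgebra.lift_ι_apply]
      refine hweyl i _ _ ?_
      rw [h.smul_yxCoeff hr hs, yxCoeff, smul_comm (r i ^ 2), ← smul_sub]
      rw [inv_smul_eq_iff₀ (hd i)]
      module
    | weylS i =>
      simp only [gi, map_mul, map_sub, map_smul, FreeAlgebra.lift_ι_apply]
      refine hweyl i _ _ ?_
      rw [h.smul_yxCoeff hr hs, yxCoeff, smul_comm (s i ^ 2), ← smul_sub]
      rw [inv_smul_eq_iff₀ (hd i)]
      module⟩

theorem toSkew_gen (h : IsTorusAction r s ρ σ) (hr : ∀ i, r i ≠ 0) (hs : ∀ i, s i ≠ 0)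
    (hd : ∀ i, s i ^ 2 - r i ^ 2 ≠ 0) (w : WGen n) :
    toSkew h hr hs hd (gen r s w) = skewGen r s ρ σ w := by
  simp [toSkew, gen, gi]

end Representation

section NormalForm

variable {K : Type} [Field K] {n : ℕ} {r s : Fin n → K}

/-- The element `x_i ^ m` for `m ≥ 0` and `y_i ^ (-m)` for `m < 0`. -/
noncomputable def xyPow (r s : Fin n → K) (i : Fin n) : ℤ → MWA K n r s
  | .ofNat m => gen r s (.x i) ^ m
  | .negSucc m => gen r s (.y i) ^ (m + 1)

theorem commute_xyPow {i j : Fin n} (hij : i ≠ j) (a b : ℤ) :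
    Commute (xyPow r s i a) (xyPow r s j b) := by
  cases a <;> cases b <;> refine Commute.pow_pow ?_ _ _
  · exact x_mul_x i j
  · exact (y_mul_x_of_ne hij.symm).symm
  · exact y_mul_x_of_ne hij
  · exact y_mul_y i j

theorem exists_x_mul_xyPow {j : Fin n} (hj : s j ^ 2 - r j ^ 2 ≠ 0) (m : ℤ) :
    ∃ u ∈ torusSubalgebra r s, gen r s (.x j) * xyPow r s j m = u * xyPow r s j (1 + m) := by
  rcases m with m | m
  · refine ⟨1, one_mem _, ?_⟩
    rw [one_mul, show 1 + Int.ofNat m = Int.ofNat (m + 1) from add_comm _ _]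
    exact (pow_succ' _ m).symm
  · refine ⟨_, x_mul_y_mem hj, ?_⟩
    have h : xyPow r s j (1 + Int.negSucc m) = gen r s (.y j) ^ m := by
      cases m with
      | zero => exact (pow_zero (gen r s (.x j))).trans (pow_zero (gen r s (.y j))).symm
      | succ m => rw [show 1 + Int.negSucc (m + 1) = Int.negSucc m by lia]; rfl
    rw [h, mul_assoc, ← pow_succ']
    rfl

theorem exists_y_mul_xyPow {j : Fin n} (hj : s j ^ 2 - r j ^ 2 ≠ 0) (m : ℤ) :
    ∃ u ∈ torusSubalgebra r s, gen r s (.y j) * xyPow r s j m = u * xyPow r s j (-1 + m) := by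
  rcases m with m | m
  · cases m with
    | zero =>
      refine ⟨1, one_mem _, ?_⟩
      rw [one_mul]
      change _ * gen r s (.x j) ^ 0 = gen r s (.y j) ^ (0 + 1)
      rw [pow_zero, zero_add, pow_one, mul_one]
    | succ m =>
      refine ⟨_, y_mul_x_mem hj, ?_⟩
      rw [show -1 + Int.ofNat (m + 1) = Int.ofNat m by lia, mul_assoc]
      exact congrArg _ (pow_succ' _ m)
  · refine ⟨1, one_mem _, ?_⟩
    rw [one_mul, show -1 + Int.negSucc m = Int.negSucc (m + 1) by lia]
    exact (pow_succ' _ (m + 1)).symm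

theorem pairwise_commute_xyPow (k : Fin n → Multiplicative ℤ) (S : Set (Fin n)) :
    S.Pairwise (Function.onFun Commute fun i => xyPow r s i (k i).toAdd) :=
  fun _ _ _ _ hij => commute_xyPow hij _ _

/-- The normal monomial in the `x_i` and `y_i` with exponent vector `k`. -/
noncomputable def monomialXY (r s : Fin n → K) (k : Fin n → Multiplicative ℤ) : MWA K n r s :=
  Finset.univ.noncommProd (fun i => xyPow r s i (k i).toAdd) (pairwise_commute_xyPow k _)

theorem exists_mul_monomialXY {a : MWA K n r s} {j : Fin n} {m : ℤ}
    (ha : ∀ b, ∃ u ∈ torusSubalgebra r s, a * xyPow r s j b = u * xyPow r s j (m + b))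
    (k : Fin n → Multiplicative ℤ) :
    ∃ u ∈ torusSubalgebra r s, ∃ k', a * monomialXY r s k = u * monomialXY r s k' := by
  obtain ⟨u, hu, h⟩ := ha (k j).toAdd
  refine ⟨u, hu, Pi.mulSingle j (Multiplicative.ofAdd m) * k, ?_⟩
  unfold monomialXY
  rw [← Finset.mul_noncommProd_erase _ (Finset.mem_univ j),
    ← Finset.mul_noncommProd_erase _ (Finset.mem_univ j), ← mul_assoc, ← mul_assoc, h]
  congr 1
  · simp
  · refine Finset.noncommProd_congr rfl (fun i hi => ?_) _
    rw [Pi.mul_apply, Pi.mulSingle_eq_of_ne (Finset.ne_of_mem_erase hi), one_mul]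

/-- The torus subalgebra is normalized by the generators. -/
theorem exists_gen_mul_torus (hr : ∀ i, r i ≠ 0) (hs : ∀ i, s i ≠ 0) (w : WGen n)
    {c : MWA K n r s} (hc : c ∈ torusSubalgebra r s) :
    ∃ c' ∈ torusSubalgebra r s, gen r s w * c = c' * gen r s w := by
  induction hc using Algebra.adjoin_induction with
  | mem t ht =>
    obtain ⟨p, rfl⟩ := ht
    obtain ⟨c, -, h⟩ := exists_mul_gen_tor hr hs p w
    exact ⟨_, Subalgebra.smul_mem _ (gen_tor_mem p) c, by rw [h, smul_mul_assoc]⟩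
  | algebraMap c => exact ⟨_, Subalgebra.algebraMap_mem _ c, (Algebra.commutes c _).symm⟩
  | add a b _ _ ha hb =>
    obtain ⟨a', ha', ha⟩ := ha
    obtain ⟨b', hb', hb⟩ := hb
    exact ⟨_, add_mem ha' hb', by rw [mul_add, ha, hb, add_mul]⟩
  | mul a b _ _ ha hb =>
    obtain ⟨a', ha', ha⟩ := ha
    obtain ⟨b', hb', hb⟩ := hb
    exact ⟨_, mul_mem ha' hb', by rw [← mul_assoc, ha, mul_assoc, hb, mul_assoc]⟩

theorem exists_gen_mul_monomialXY (hd : ∀ i, s i ^ 2 - r i ^ 2 ≠ 0) (w : WGen n)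
    (k : Fin n → Multiplicative ℤ) :
    ∃ u ∈ torusSubalgebra r s, ∃ k', gen r s w * monomialXY r s k = u * monomialXY r s k' := by
  rcases wgen_cases w with ⟨p, rfl⟩ | ⟨i, rfl⟩ | ⟨i, rfl⟩
  · exact ⟨_, gen_tor_mem p, k, rfl⟩
  · exact exists_mul_monomialXY (exists_x_mul_xyPow (hd i)) k
  · exact exists_mul_monomialXY (exists_y_mul_xyPow (hd i)) k

theorem monomialXY_one : monomialXY r s 1 = 1 := by
  refine (Finset.noncommProd_eq_pow_card _ _ _ 1 fun i _ => ?_).trans (one_pow _)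
  exact pow_zero (gen r s (.x i))

theorem span_eq_top_of_mul_mem {A ι : Type*} [Ring A] [Algebra K A] {g : ι → A}
    (hg : Algebra.adjoin K (Set.range g) = ⊤) {S : Set A} (h1 : 1 ∈ S)
    (hS : ∀ w, ∀ a ∈ S, g w * a ∈ S) : Submodule.span K S = ⊤ := by
  have key (a : A) (ha : a ∈ Algebra.adjoin K (Set.range g)) :
      ∀ b ∈ Submodule.span K S, a * b ∈ Submodule.span K S := by
    induction ha using Algebra.adjoin_induction with
    | mem t ht =>
      obtain ⟨w, rfl⟩ := ht
      intro b hb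
      induction hb using Submodule.span_induction with
      | mem b hb => exact Submodule.subset_span (hS w b hb)
      | zero => simp
      | add b c _ _ hb hc => rw [mul_add]; exact add_mem hb hc
      | smul c b _ hb => rw [mul_smul_comm]; exact Submodule.smul_mem _ c hb
    | algebraMap c =>
      intro b hb
      rw [← Algebra.smul_def]
      exact Submodule.smul_mem _ c hb
    | add a b _ _ ha hb =>
      intro c hc
      rw [add_mul]
      exact add_mem (ha c hc) (hb c hc)
    | mul a b _ _ ha hb =>
      intro c hc
      rw [mul_assoc]
      exact ha _ (hb c hc)
  refine eq_top_iff.2 fun a _ => ?_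
  rw [← mul_one a]
  exact key a (hg ▸ Algebra.mem_top) 1 (Submodule.subset_span h1)

/-- The normal monomials span the multiparameter Weyl algebra over the torus subalgebra. -/
theorem span_torus_mul_monomialXY (hr : ∀ i, r i ≠ 0) (hs : ∀ i, s i ≠ 0)
    (hd : ∀ i, s i ^ 2 - r i ^ 2 ≠ 0) :
    Submodule.span K {a : MWA K n r s | ∃ c ∈ torusSubalgebra r s, ∃ k,
      a = c * monomialXY r s k} = ⊤ := by
  refine span_eq_top_of_mul_mem adjoin_range_gen ?_ ?_
  · exact ⟨1, one_mem _, 1, by rw [monomialXY_one, one_mul]⟩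
  · rintro w _ ⟨c, hc, k, rfl⟩
    obtain ⟨c', hc', h⟩ := exists_gen_mul_torus hr hs w hc
    obtain ⟨u, hu, k', h'⟩ := exists_gen_mul_monomialXY hd w k
    exact ⟨c' * u, mul_mem hc' hu, k', by rw [← mul_assoc, h, mul_assoc, h', mul_assoc]⟩

end NormalForm

section Injectivity

open SkewMonoidAlgebra

variable {K : Type} [Field K] {R G : Type*} [CommRing R] [IsDomain R] [Algebra K R] [Group G]
  [MulSemiringAction G R]

theorem exists_single_mul {a b : SkewMonoidAlgebra R G} {g h : G}
    (ha : ∃ p ≠ 0, a = single g p) (hb : ∃ p ≠ 0, b = single h p) :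
    ∃ p ≠ 0, a * b = single (g * h) p := by
  obtain ⟨p, hp, rfl⟩ := ha
  obtain ⟨q, hq, rfl⟩ := hb
  exact ⟨_, mul_ne_zero hp ((smul_ne_zero_iff_ne g).2 hq), single_mul_single⟩

theorem exists_single_pow {a : SkewMonoidAlgebra R G} {g : G}
    (ha : ∃ p ≠ 0, a = single g p) (m : ℕ) : ∃ p ≠ 0, a ^ m = single (g ^ m) p := by
  induction m with
  | zero => exact ⟨1, one_ne_zero, by rw [pow_zero, pow_zero, one_def]⟩
  | succ m ih =>
    rw [pow_succ, pow_succ]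
    exact exists_single_mul ih ha

theorem injective_of_span_eq_top [SMulCommClass G K R] {A : Type*} [Ring A] [Algebra K A]
    {z : G → A} {ι : R →ₐ[K] A} (hspan : Submodule.span K {a | ∃ c k, a = ι c * z k} = ⊤)
    {φ : A →ₐ[K] SkewMonoidAlgebra R G} (hι : ∀ c, φ (ι c) = single 1 c)
    (hz : ∀ k, ∃ p ≠ 0, φ (z k) = single k p) : Function.Injective φ := by
  choose p hp hpz using hz
  have hsurj (a : A) : ∃ f : G →₀ R, a = f.sum fun k c => ι c * z k := by
    have ha : a ∈ Submodule.span K {a | ∃ c k, a = ι c * z k} := hspan ▸ Submodule.mem_top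
    induction ha using Submodule.span_induction with
    | mem a ha =>
      obtain ⟨c, k, rfl⟩ := ha
      exact ⟨Finsupp.single k c, by rw [Finsupp.sum_single_index]; simp⟩
    | zero => exact ⟨0, by simp⟩
    | add a b _ _ ha hb =>
      obtain ⟨f, rfl⟩ := ha
      obtain ⟨g, rfl⟩ := hb
      refine ⟨f + g, ?_⟩
      classical
      rw [Finsupp.sum_add_index] <;> simp [add_mul]
    | smul c a _ ha =>
      obtain ⟨f, rfl⟩ := ha
      refine ⟨c • f, ?_⟩
      rw [Finsupp.sum_smul_index' (by simp), Finsupp.smul_sum]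
      simp
  refine (injective_iff_map_eq_zero φ).2 fun a ha => ?_
  obtain ⟨f, rfl⟩ := hsurj a
  suffices f = 0 by rw [this, Finsupp.sum_zero_index]
  ext k
  let coeffHom : SkewMonoidAlgebra R G →+ R :=
    { toFun b := b.coeff k, map_zero' := rfl, map_add' _ _ := by rw [coeff_add, Finsupp.add_apply] }
  have hterm (g : G) (c : R) : coeffHom (φ (ι c * z g)) = Finsupp.single g (c * p g) k := by
    rw [map_mul, hι, hpz, single_mul_single, one_smul, one_mul]
    rfl
  have hk : coeffHom (φ (f.sum fun g c => ι c * z g)) = f k * p k := by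
    rw [map_finsuppSum, map_finsuppSum]
    simp only [hterm]
    rw [Finsupp.sum, Finset.sum_eq_single k, Finsupp.single_eq_same]
    · exact fun g _ hg => Finsupp.single_eq_of_ne hg.symm
    · intro h
      rw [Finsupp.notMem_support_iff.1 h, zero_mul, Finsupp.single_zero, Finsupp.zero_apply]
  rw [ha, map_zero] at hk
  exact (mul_eq_zero.1 hk.symm).resolve_right (hp k)

end Injectivity

section Domain

open SkewMonoidAlgebra

variable {K : Type} [Field K] {n : ℕ} {r s : Fin n → K}
  {R : Type} [CommRing R] [IsDomain R] [Algebra K R] [MulSemiringAction (Fin n → Multiplicative ℤ) R]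
  [SMulCommClass (Fin n → Multiplicative ℤ) K R] {ρ σ : Fin n → Rˣ}

theorem exists_toSkew_xyPow (h : IsTorusAction r s ρ σ) (hr : ∀ i, r i ≠ 0) (hs : ∀ i, s i ≠ 0)
    (hd : ∀ i, s i ^ 2 - r i ^ 2 ≠ 0) {i : Fin n} (hi : yxCoeff r s ρ σ i ≠ 0)
    (m : Multiplicative ℤ) :
    ∃ p ≠ 0, toSkew h hr hs hd (xyPow r s i m.toAdd) = single (Pi.mulSingle i m) p := by
  induction m using Multiplicative.rec with | _ m =>
  rcases m with m | m
  · have := exists_single_pow (a := toSkew h hr hs hd (gen r s (.x i)))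
      ⟨1, one_ne_zero, toSkew_gen h hr hs hd _⟩ m
    rw [← map_pow, ← Pi.mulSingle_pow, ← ofAdd_nsmul, nsmul_one] at this
    exact this
  · have := exists_single_pow (a := toSkew h hr hs hd (gen r s (.y i)))
      ⟨_, hi, toSkew_gen h hr hs hd _⟩ (m + 1)
    rw [← map_pow, inv_pow, ← Pi.mulSingle_pow, ← Pi.mulSingle_inv, ← ofAdd_nsmul, nsmul_one,
      ← ofAdd_neg] at this
    exact this

theorem exists_toSkew_monomialXY (h : IsTorusAction r s ρ σ) (hr : ∀ i, r i ≠ 0)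
    (hs : ∀ i, s i ≠ 0) (hd : ∀ i, s i ^ 2 - r i ^ 2 ≠ 0) (hyx : ∀ i, yxCoeff r s ρ σ i ≠ 0)
    (k : Fin n → Multiplicative ℤ) :
    ∃ p ≠ 0, toSkew h hr hs hd (monomialXY r s k) = single k p := by
  have key (S : Finset (Fin n)) : ∃ p ≠ 0, toSkew h hr hs hd
      (S.noncommProd (fun i => xyPow r s i (k i).toAdd) (pairwise_commute_xyPow k _)) =
        single (∏ i ∈ S, Pi.mulSingle i (k i)) p := by
    induction S using Finset.induction_on with
    | empty => exact ⟨1, one_ne_zero, by simp⟩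
    | insert i S hi ih =>
      rw [Finset.noncommProd_insert_of_notMem _ _ _ _ hi, Finset.prod_insert hi, map_mul]
      exact exists_single_mul (exists_toSkew_xyPow h hr hs hd (hyx i) (k i)) ih
  have := key Finset.univ
  rwa [Finset.univ_prod_mulSingle] at this

theorem isDomain_of_isTorusAction (h : IsTorusAction r s ρ σ) (hr : ∀ i, r i ≠ 0)
    (hs : ∀ i, s i ≠ 0) (hd : ∀ i, s i ^ 2 - r i ^ 2 ≠ 0) (hyx : ∀ i, yxCoeff r s ρ σ i ≠ 0)
    {ι : R →ₐ[K] MWA K n r s} (hι : ∀ c, toSkew h hr hs hd (ι c) = single 1 c)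
    (hrange : torusSubalgebra r s ≤ ι.range) : IsDomain (MWA K n r s) := by
  have hinj : Function.Injective (toSkew h hr hs hd) := by
    refine injective_of_span_eq_top (z := monomialXY r s) (ι := ι) ?_ hι
      (exists_toSkew_monomialXY h hr hs hd hyx)
    rw [eq_top_iff, ← span_torus_mul_monomialXY hr hs hd]
    refine Submodule.span_mono ?_
    rintro _ ⟨c, hc, k, rfl⟩
    obtain ⟨c, rfl⟩ := hrange hc
    exact ⟨c, k, rfl⟩
  have := noZeroDivisors_skewMonoidAlgebra (R := R) (G := Fin n → Multiplicative ℤ)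
  have : NoZeroDivisors (MWA K n r s) := hinj.noZeroDivisors _ (map_zero _) (map_mul _)
  have : Nontrivial (MWA K n r s) := (toSkew h hr hs hd).toRingHom.domain_nontrivial
  exact NoZeroDivisors.to_isDomain _

end Domain

section FreeAbelian

variable {ι M : Type*}

theorem pairwise_commute_zpowersHom [Group M] {u : ι → M} (hu : ∀ i j, Commute (u i) (u j)) :
    Pairwise fun i j => ∀ x y, Commute (zpowersHom M (u i) x) (zpowersHom M (u j) y) :=
  fun i j _ _ _ => (hu i j).zpow_zpow _ _

/-- The homomorphism from `ℤ ^ ι` determined by a family of commuting elements of a group. -/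
def piIntLift [Fintype ι] [Group M] (u : ι → M) (hu : ∀ i j, Commute (u i) (u j)) :
    (ι → Multiplicative ℤ) →* M :=
  MonoidHom.noncommPiCoprod (fun i => zpowersHom M (u i)) (pairwise_commute_zpowersHom hu)

variable [Fintype ι] [DecidableEq ι]

theorem piIntLift_mulSingle [Group M] (u : ι → M) (hu : ∀ i j, Commute (u i) (u j)) (i : ι) :
    piIntLift u hu (Pi.mulSingle i (Multiplicative.ofAdd 1)) = u i := by
  rw [piIntLift, MonoidHom.noncommPiCoprod_mulSingle, zpowersHom_apply, toAdd_ofAdd, zpow_one]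

theorem piInt_hom_ext [Monoid M] {f g : (ι → Multiplicative ℤ) →* M}
    (h : ∀ i, f (Pi.mulSingle i (Multiplicative.ofAdd 1)) =
      g (Pi.mulSingle i (Multiplicative.ofAdd 1))) : f = g :=
  MonoidHom.pi_ext fun i x => DFunLike.congr_fun
    (MonoidHom.ext_mint (f := f.comp (MonoidHom.mulSingle (fun _ => Multiplicative ℤ) i))
      (g := g.comp (MonoidHom.mulSingle (fun _ => Multiplicative ℤ) i)) (h i)) x

end FreeAbelian

section Twist

variable {K H : Type*} [Field K] [CommGroup H]

/-- A character of `H` acts on the group algebra of `H` by rescaling the group elements. -/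
noncomputable def characterAction : (H →* Kˣ) →* (MonoidAlgebra K H →ₐ[K] MonoidAlgebra K H) where
  toFun c := MonoidAlgebra.lift K _ H
    { toFun h := MonoidAlgebra.single h (c h : K)
      map_one' := by simp [MonoidAlgebra.one_def]
      map_mul' := by simp [MonoidAlgebra.single_mul_single] }
  map_one' := by
    ext h
    simp
  map_mul' c d := by
    ext h
    simp [mul_comm]

theorem characterAction_of (c : H →* Kˣ) (h : H) :
    characterAction c (MonoidAlgebra.of K H h) = (c h : K) • MonoidAlgebra.of K H h := by
  simp [characterAction]

end Twist

section Torus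

variable {K : Type} [Field K] {n : ℕ}

/-- The character group of the torus with coordinates `ρ_i` and `σ_i`. -/
abbrev TorusGroup (n : ℕ) : Type := Fin n × Bool → Multiplicative ℤ

/-- The monomial `ρ_i` (for `b = false`) or `σ_i` (for `b = true`). -/
noncomputable def torusCoord (K : Type) [Field K] (p : Fin n × Bool) :
    (MonoidAlgebra K (TorusGroup n))ˣ :=
  Units.map (MonoidAlgebra.of K (TorusGroup n))
    (toUnits (Pi.mulSingle p (Multiplicative.ofAdd 1)))

theorem coe_torusCoord (p : Fin n × Bool) : (torusCoord K p : MonoidAlgebra K (TorusGroup n)) =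
    MonoidAlgebra.of K (TorusGroup n) (Pi.mulSingle p (Multiplicative.ofAdd 1)) := rfl

theorem coe_torusCoord_inv (p : Fin n × Bool) :
    (↑(torusCoord K p)⁻¹ : MonoidAlgebra K (TorusGroup n)) =
      MonoidAlgebra.of K (TorusGroup n) (Pi.mulSingle p (Multiplicative.ofAdd 1))⁻¹ := rfl

/-- The character that takes the value `q p` at the coordinates `p` with index `j` and is trivial
at the other coordinates. -/
def indexCharacter (q : Fin n × Bool → Kˣ) (j : Fin n) : TorusGroup n →* Kˣ :=
  piIntLift (fun p => if p.1 = j then q p else 1) fun _ _ => .all _ _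

theorem commute_indexCharacter (q : Fin n × Bool → Kˣ) (i j : Fin n) :
    Commute (indexCharacter q i) (indexCharacter q j) :=
  MonoidHom.ext fun _ => mul_comm _ _

/-- The action of `ℤ ^ n` on the torus by characters, where the `j`-th generator rescales the
coordinates with index `j`. -/
noncomputable def torusActionHom (q : Fin n × Bool → Kˣ) : (Fin n → Multiplicative ℤ) →*
    (MonoidAlgebra K (TorusGroup n) →ₐ[K] MonoidAlgebra K (TorusGroup n)) :=
  characterAction.comp (piIntLift (indexCharacter q) (commute_indexCharacter q))

theorem torusActionHom_coord (q : Fin n × Bool → Kˣ) (j : Fin n) (p : Fin n × Bool) :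
    torusActionHom q (basisElt j) (torusCoord K p) =
      (if p.1 = j then (q p : K) else 1) • (torusCoord K p : MonoidAlgebra K (TorusGroup n)) := by
  rw [coe_torusCoord, torusActionHom, MonoidHom.comp_apply, piIntLift_mulSingle,
    characterAction_of, indexCharacter, piIntLift_mulSingle]
  split_ifs <;> rfl

/-- The action of `ℤ ^ n` on the coordinate ring of the torus. -/
noncomputable abbrev torusAction (q : Fin n × Bool → Kˣ) :
    MulSemiringAction (Fin n → Multiplicative ℤ) (MonoidAlgebra K (TorusGroup n)) where
  smul g a := torusActionHom q g a
  one_smul a := by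
    change torusActionHom q 1 a = a
    rw [map_one]
    rfl
  mul_smul g h a := by
    change torusActionHom q (g * h) a = torusActionHom q g (torusActionHom q h a)
    rw [map_mul]
    rfl
  smul_zero g := map_zero (torusActionHom q g)
  smul_add g := map_add (torusActionHom q g)
  smul_one g := map_one (torusActionHom q g)
  smul_mul g := map_mul (torusActionHom q g)

theorem yxCoeff_torusCoord_ne_zero {r s : Fin n → K} (hs : ∀ i, s i ≠ 0)
    (hd : ∀ i, s i ^ 2 - r i ^ 2 ≠ 0) (i : Fin n) :
    yxCoeff r s (fun i => torusCoord K (i, false)) (fun i => torusCoord K (i, true)) i ≠ 0 := by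
  refine smul_ne_zero (inv_ne_zero (hd i)) fun h => ?_
  rw [coe_torusCoord, coe_torusCoord, ← map_pow, ← map_pow] at h
  have hne : (Pi.mulSingle (i, false) (Multiplicative.ofAdd 1) : TorusGroup n) ^ 2 ≠
      Pi.mulSingle (i, true) (Multiplicative.ofAdd 1) ^ 2 := fun he => by
    have := congrFun he (i, true)
    simp only [Pi.pow_apply, Pi.mulSingle_eq_same, ne_eq, Prod.mk.injEq, Bool.true_eq_false,
      and_false, not_false_eq_true, Pi.mulSingle_eq_of_ne, one_pow] at this
    exact absurd this (by decide)
  have hc := congrArg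
    (fun a => a.coeff (Pi.mulSingle (i, true) (Multiplicative.ofAdd 1) ^ 2)) h
  simp [Finsupp.single_eq_of_ne hne.symm, hs i] at hc

variable {r s : Fin n → K}

/-- The units `ρ_i` and `σ_i` of the multiparameter Weyl algebra. -/
noncomputable def torusUnit (r s : Fin n → K) : Fin n × Bool → (MWA K n r s)ˣ
  | (i, false) => ⟨_, _, rho_mul_rhoInv i, rhoInv_mul_rho i⟩
  | (i, true) => ⟨_, _, sg_mul_sgInv i, sgInv_mul_sg i⟩

theorem commute_torusUnit (p q : Fin n × Bool) : Commute (torusUnit r s p) (torusUnit r s q) := by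
  have key (p : Fin n × Bool) : ∃ t, (torusUnit r s p : MWA K n r s) = gen r s (tor n t) := by
    rcases p with ⟨i, _ | _⟩
    exacts [⟨(i, 0), rfl⟩, ⟨(i, 2), rfl⟩]
  obtain ⟨t, ht⟩ := key p
  obtain ⟨u, hu⟩ := key q
  refine Units.ext ?_
  rw [Units.val_mul, Units.val_mul, ht, hu, gen_tor_mul]

/-- The homomorphism from the coordinate ring of the torus to the multiparameter Weyl algebra. -/
noncomputable def ofTorus (r s : Fin n → K) :
    MonoidAlgebra K (TorusGroup n) →ₐ[K] MWA K n r s :=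
  MonoidAlgebra.lift K _ _
    ((Units.coeHom _).comp (piIntLift (torusUnit r s) commute_torusUnit))

theorem ofTorus_of (h : TorusGroup n) : ofTorus r s (MonoidAlgebra.of K _ h) =
    piIntLift (torusUnit r s) commute_torusUnit h :=
  MonoidAlgebra.lift_of _ _

theorem ofTorus_coord (p : Fin n × Bool) :
    ofTorus r s (torusCoord K p) = torusUnit r s p := by
  rw [coe_torusCoord, ofTorus_of, piIntLift_mulSingle]

theorem ofTorus_coord_inv (p : Fin n × Bool) :
    ofTorus r s ↑(torusCoord K p)⁻¹ = ↑(torusUnit r s p)⁻¹ := by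
  rw [coe_torusCoord_inv, ofTorus_of, map_inv, piIntLift_mulSingle]

theorem torusSubalgebra_le_range_ofTorus : torusSubalgebra r s ≤ (ofTorus r s).range := by
  refine Algebra.adjoin_le ?_
  rintro _ ⟨⟨i, t⟩, rfl⟩
  fin_cases t
  · exact ⟨_, ofTorus_coord (i, false)⟩
  · exact ⟨_, ofTorus_coord_inv (i, false)⟩
  · exact ⟨_, ofTorus_coord (i, true)⟩
  · exact ⟨_, ofTorus_coord_inv (i, true)⟩

/-- The multiparameter Weyl algebra is a domain. -/
theorem isDomain_mwa (hr : ∀ i, r i ≠ 0) (hs : ∀ i, s i ≠ 0)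
    (hd : ∀ i, s i ^ 2 - r i ^ 2 ≠ 0) : IsDomain (MWA K n r s) := by
  let q (p : Fin n × Bool) : Kˣ :=
    if p.2 then (Units.mk0 _ (hs p.1))⁻¹ else (Units.mk0 _ (hr p.1))⁻¹
  let _ := torusAction q
  have : SMulCommClass (Fin n → Multiplicative ℤ) K (MonoidAlgebra K (TorusGroup n)) :=
    ⟨fun g c a => map_smul (torusActionHom q g) c a⟩
  have h : IsTorusAction r s (fun i => torusCoord K (i, false)) fun i => torusCoord K (i, true) :=
    ⟨fun i j => (torusActionHom_coord q j (i, false)).trans (by simp [q]),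
      fun i j => (torusActionHom_coord q j (i, true)).trans (by simp [q])⟩
  refine isDomain_of_isTorusAction h hr hs hd (yxCoeff_torusCoord_ne_zero hs hd)
    (ι := ofTorus r s) (fun c => ?_) torusSubalgebra_le_range_ofTorus
  have hsingle (p : Fin n × Bool) : toSkew h hr hs hd (ofTorus r s (torusCoord K p)) =
      SkewMonoidAlgebra.single 1 (torusCoord K p : MonoidAlgebra K (TorusGroup n)) := by
    rw [ofTorus_coord]
    rcases p with ⟨i, _ | _⟩ <;> exact toSkew_gen h hr hs hd _
  have hof : ((toSkew h hr hs hd).toMonoidHom.comp (ofTorus r s).toMonoidHom).comp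
      (MonoidAlgebra.of K (TorusGroup n)) =
      (SkewMonoidAlgebra.singleOneRingHom (G := Fin n → Multiplicative ℤ)).toMonoidHom.comp
        (MonoidAlgebra.of K (TorusGroup n)) := piInt_hom_ext hsingle
  induction c using MonoidAlgebra.induction_on with
  | of g => exact DFunLike.congr_fun hof g
  | add a b ha hb => rw [map_add, map_add, ha, hb, SkewMonoidAlgebra.single_add]
  | smul c a ha => rw [map_smul, map_smul, ha, SkewMonoidAlgebra.smul_single]

end Torus

/-- If the parameters are generic (the only `(d,d') ∈ ℤ²` with
`r_i^d s_i^{d'} = 1` is `(0,0)`), then the multiparameter Weyl algebra `A_{r,s}(n)` is a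
left and right Noetherian domain. -/
theorem statement18
    (K : Type) [Field K] (n : ℕ) (r s : Fin n → K)
    (hr : ∀ i, r i ≠ 0) (hs : ∀ i, s i ≠ 0)
    (hrs : ∀ i, (r i * (s i)⁻¹) ^ 2 ≠ 1)
    (hgen : ∀ i : Fin n, ∀ d d' : ℤ, r i ^ d * s i ^ d' = 1 → d = 0 ∧ d' = 0) :
    IsDomain (MWA K n r s) ∧
    IsNoetherianRing (MWA K n r s) ∧
    IsNoetherianRing (MWA K n r s)ᵐᵒᵖ := by
  have hd (i : Fin n) : s i ^ 2 - r i ^ 2 ≠ 0 := fun h => hrs i <| by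
    rw [mul_pow, ← sub_eq_zero.1 h, inv_pow, mul_inv_cancel₀ (pow_ne_zero 2 (hs i))]
  have hN := isNoetherianRing_mwa hr hs hd
  exact ⟨isDomain_mwa hr hs hd, hN, isNoetherianRing_of_surjective _ _
    (antiInvolution hr hs).toRingHom (antiInvolution_surjective hr hs)⟩

end MTW
end

section
/- The z_i are invertible in the localization S^{-1}P, and there is a unique K-algebra homomorphism ψ : R → S^{-1}P with ψ(u_i) = −q_i^{-1} z_{i−1} and ψ(v_i) = −z_i for i = 1,…,n (where z_0 = 1); moreover ψ is surjective, satisfies ψ∘σ_i = τ̃_i∘ψ for each i (where τ̃_i is the automorphism of S^{-1}P induced by τ_i), and ψ(t_i) = s_i for each i. -/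
namespace MTW

abbrev Exp (n : ℕ) : Type := (Fin n → ℤ) × (Fin n → ℤ)

abbrev LR (K : Type) [Field K] (n : ℕ) : Type := AddMonoidAlgebra K (Exp n)

noncomputable def mon (K : Type) [Field K] (n : ℕ) (d : Exp n) : LR K n :=
  AddMonoidAlgebra.single d 1

noncomputable def U (K : Type) [Field K] (n : ℕ) (j : Fin n) : LR K n :=
  mon K n (Pi.single j 1, 0)

noncomputable def V (K : Type) [Field K] (n : ℕ) (j : Fin n) : LR K n :=
  mon K n (0, Pi.single j 1)

noncomputable def tElt (K : Type) [Field K] (n : ℕ) (k : ℤ) (r s : Fin n → Fin n → K)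
    (i : Fin n) : LR K n :=
  (r i i ^ k - s i i ^ k)⁻¹ •
    (r i i ^ k • mon K n (Pi.single i k, 0) - s i i ^ k • mon K n (0, Pi.single i k))

noncomputable def sigmaZ (K : Type) [Field K] (n : ℕ)
    (σ : Fin n → (LR K n ≃ₐ[K] LR K n)) (g : Fin n → ℤ) : LR K n ≃ₐ[K] LR K n :=
  (List.ofFn fun i => σ i ^ (g i)).prod

def IsInvariantIdeal (K : Type) [Field K] (n : ℕ)
    (σ : Fin n → (LR K n ≃ₐ[K] LR K n)) (J : Ideal (LR K n)) : Prop :=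
  ∀ (g : Fin n → ℤ), ∀ x ∈ J, sigmaZ K n σ g x ∈ J

noncomputable def invariants (K : Type) [Field K] (n : ℕ)
    (σ : Fin n → (LR K n ≃ₐ[K] LR K n)) : Subalgebra K (LR K n) :=
  ⨅ i, AlgHom.equalizer (σ i).toAlgHom (AlgHom.id K (LR K n))

open MvPolynomial in
/-- `z_j = 1 + Σ_{k ≤ j} (q_k − 1) s_k` in `P = K[s_1,…,s_n]` (0-based indexing). -/
noncomputable def zP (K : Type) [Field K] (n : ℕ) (q : Fin n → K) (j : Fin n) :
    MvPolynomial (Fin n) K :=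
  1 + ∑ l ∈ Finset.univ.filter (fun l => l ≤ j), C (q l - 1) * X l

/-- `z_{i-1}`, with `z_0 = 1`. -/
noncomputable def zPrev (K : Type) [Field K] (n : ℕ) (q : Fin n → K) (i : Fin n) :
    MvPolynomial (Fin n) K :=
  if h : (i : ℕ) = 0 then 1
  else zP K n q ⟨(i : ℕ) - 1, by have := i.isLt; omega⟩

/-- The multiplicative set `S = {α z_1^{k_1}⋯z_n^{k_n} : α ∈ K∖{0}, k_i ∈ ℤ_{≥0}}`. -/
noncomputable def zS (K : Type) [Field K] (n : ℕ) (q : Fin n → K) :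
    Submonoid (MvPolynomial (Fin n) K) where
  carrier := {p | ∃ (α : K) (m : Fin n → ℕ), α ≠ 0 ∧ p = α • ∏ i, zP K n q i ^ m i}
  one_mem' := ⟨1, 0, one_ne_zero, by simp⟩
  mul_mem' := by
    rintro a b ⟨α, ma, hα, rfl⟩ ⟨β, mb, hβ, rfl⟩
    refine ⟨α * β, ma + mb, mul_ne_zero hα hβ, ?_⟩
    rw [smul_mul_assoc, mul_smul_comm, smul_smul]
    congr 1
    rw [← Finset.prod_mul_distrib]
    exact Finset.prod_congr rfl fun i _ => (pow_add _ _ _).symm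

/-- `t_i = (u_i − q_i^{-1} v_i)/(1 − q_i^{-1})` in `R`. -/
noncomputable def tQ (K : Type) [Field K] (n : ℕ) (q : Fin n → K) (i : Fin n) : LR K n :=
  (1 - (q i)⁻¹)⁻¹ • (U K n i - (q i)⁻¹ • V K n i)

theorem isUnit_mon (K : Type) [Field K] (n : ℕ) (d : Exp n) : IsUnit (mon K n d) :=
  IsUnit.of_mul_eq_one (mon K n (-d)) <| by
    simp [mon, AddMonoidAlgebra.single_mul_single, AddMonoidAlgebra.one_def]

/-- Algebra homomorphisms out of the Laurent polynomial ring are determined by the variables. -/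
theorem LR_algHom_ext {K : Type} [Field K] {n : ℕ} {B : Type*} [CommRing B] [Algebra K B]
    {f g : LR K n →ₐ[K] B} (hU : ∀ i, f (U K n i) = g (U K n i))
    (hV : ∀ i, f (V K n i) = g (V K n i)) : f = g := by
  let toAdd (h : LR K n →ₐ[K] B) : Exp n →+ Additive B :=
    MonoidHom.toAdditiveRight ((h : LR K n →* B).comp (AddMonoidAlgebra.of K (Exp n)))
  have key : toAdd f = toAdd g := by
    rw [← (toAdd f).coprod_unique, ← (toAdd g).coprod_unique]
    congr 1
    · exact AddMonoidHom.functions_ext' _ _ _ fun i => AddMonoidHom.ext_int (hU i)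
    · exact AddMonoidHom.functions_ext' _ _ _ fun i => AddMonoidHom.ext_int (hV i)
  exact AddMonoidAlgebra.algHom_ext (fun d => DFunLike.congr_fun key d) (Subsingleton.elim _ _)

/-- The variables of the Laurent polynomial ring can be sent to arbitrary units. -/
theorem exists_LR_algHom {K : Type} [Field K] {n : ℕ} {B : Type*} [CommRing B] [Algebra K B]
    (a b : Fin n → Bˣ) :
    ∃ f : LR K n →ₐ[K] B, (∀ i, f (U K n i) = a i) ∧ ∀ i, f (V K n i) = b i := by
  let toAdd (c : Fin n → Bˣ) : (Fin n → ℤ) →+ Additive Bˣ :=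
    ∑ i, (zmultiplesHom (Additive Bˣ) (.ofMul (c i))).comp (Pi.evalAddMonoidHom _ i)
  have toAdd_single (c : Fin n → Bˣ) (i : Fin n) :
      toAdd c (Pi.single i 1) = .ofMul (c i) := by
    simp only [toAdd, AddMonoidHom.finsetSum_apply, AddMonoidHom.comp_apply,
      Pi.evalAddMonoidHom_apply, zmultiplesHom_apply]
    rw [Finset.sum_eq_single i] <;> simp +contextual
  refine ⟨AddMonoidAlgebra.lift K B (Exp n) ((Units.coeHom B).comp
    (AddMonoidHom.toMultiplicativeLeft ((toAdd a).coprod (toAdd b)))), fun i => ?_, fun i => ?_⟩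
  · simp [U, mon, toAdd_single]
  · simp [V, mon, toAdd_single]

open MvPolynomial in
theorem zPrev_eq_sum (K : Type) [Field K] (n : ℕ) (q : Fin n → K) (i : Fin n) :
    zPrev K n q i = 1 + ∑ l ∈ Finset.univ.filter (fun l => l < i), C (q l - 1) * X l := by
  unfold zPrev zP
  split_ifs with h
  · have : Finset.univ.filter (fun l => l < i) = ∅ := by
      ext l; simp only [Finset.mem_filter_univ, Finset.notMem_empty, Fin.lt_def, iff_false]; omega
    simp [this]
  · congr 2
    ext l; simp only [Finset.mem_filter_univ, Fin.lt_def, Fin.le_def]; omega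

open MvPolynomial in
theorem zP_eq_zPrev_add (K : Type) [Field K] (n : ℕ) (q : Fin n → K) (i : Fin n) :
    zP K n q i = zPrev K n q i + C (q i - 1) * X i := by
  have : Finset.univ.filter (fun l => l ≤ i) =
      insert i (Finset.univ.filter (fun l => l < i)) := by
    ext l; simp [le_iff_eq_or_lt]
  rw [zPrev_eq_sum, zP, this, Finset.sum_insert (by simp)]
  ring

theorem zP_mem_zS (K : Type) [Field K] (n : ℕ) (q : Fin n → K) (i : Fin n) :
    zP K n q i ∈ zS K n q := by
  refine ⟨1, Pi.single i 1, one_ne_zero, ?_⟩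
  rw [one_smul, Finset.prod_eq_single i] <;> simp +contextual

theorem zPrev_mem_zS (K : Type) [Field K] (n : ℕ) (q : Fin n → K) (i : Fin n) :
    zPrev K n q i ∈ zS K n q := by
  unfold zPrev
  split_ifs
  exacts [one_mem _, zP_mem_zS ..]

section Tau

open MvPolynomial

variable {K : Type} [Field K] {n : ℕ} {q : Fin n → K} {i : Fin n}
  {τ : MvPolynomial (Fin n) K ≃ₐ[K] MvPolynomial (Fin n) K}

theorem tau_zPrev_of_le
    (hlt : ∀ j < i, τ (X j) = X j) {j : Fin n} (hj : j ≤ i) :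
    τ (zPrev K n q j) = zPrev K n q j := by
  simp only [zPrev_eq_sum, map_add, map_one, map_sum, map_mul]
  congr 1
  refine Finset.sum_congr rfl fun l hl => ?_
  rw [hlt l ((Finset.mem_filter.1 hl).2.trans_le hj), ← algebraMap_eq, AlgEquiv.commutes]

theorem tau_zP_of_lt
    (hlt : ∀ j < i, τ (X j) = X j) {j : Fin n} (hj : j < i) :
    τ (zP K n q j) = zP K n q j := by
  rw [zP_eq_zPrev_add, map_add, tau_zPrev_of_le hlt hj.le, map_mul, hlt j hj, ← algebraMap_eq,
    AlgEquiv.commutes]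

theorem tau_zP_of_le
    (hlt : ∀ j < i, τ (X j) = X j)
    (heq : τ (X i) = zPrev K n q i + C (q i) * X i)
    (hgt : ∀ j, i < j → τ (X j) = C (q i) * X j) {j : Fin n} (hj : i ≤ j) :
    τ (zP K n q j) = C (q i) * zP K n q j := by
  have split : zP K n q j = zP K n q i +
      ∑ l ∈ Finset.univ.filter (fun l => i < l ∧ l ≤ j), C (q l - 1) * X l := by
    have : Finset.univ.filter (fun l => l ≤ j) = Finset.univ.filter (fun l => l ≤ i) ∪
        Finset.univ.filter (fun l => i < l ∧ l ≤ j) := by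
      have := Fin.le_def.1 hj
      ext l; simp only [Finset.mem_filter_univ, Finset.mem_union, Fin.lt_def, Fin.le_def]; omega
    rw [zP, zP, this, Finset.sum_union, add_assoc]
    refine Finset.disjoint_filter.2 fun l _ h h' => absurd h'.1 (not_lt.2 h)
  rw [split, map_add, mul_add, map_sum, Finset.mul_sum]
  congr 1
  · rw [zP_eq_zPrev_add, map_add, tau_zPrev_of_le hlt le_rfl, map_mul, heq, ← algebraMap_eq,
      AlgEquiv.commutes, algebraMap_eq, C_sub, C_1]
    ring
  · refine Finset.sum_congr rfl fun l hl => ?_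
    rw [map_mul, hgt l (Finset.mem_filter.1 hl).2.1, ← algebraMap_eq, AlgEquiv.commutes]
    ring

theorem tau_zPrev_of_lt
    (hlt : ∀ j < i, τ (X j) = X j)
    (heq : τ (X i) = zPrev K n q i + C (q i) * X i)
    (hgt : ∀ j, i < j → τ (X j) = C (q i) * X j) {j : Fin n} (hj : i < j) :
    τ (zPrev K n q j) = C (q i) * zPrev K n q j := by
  have hj' := Fin.lt_def.1 hj
  rw [zPrev, dif_neg (by omega)]
  exact tau_zP_of_le hlt heq hgt (Fin.le_def.2 (by simp only; omega))

end Tau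

/-- A homomorphism sending `v_i` to `-z_i` is surjective once its range contains `P`. -/
theorem surjective_of_map_V {K : Type} [Field K] {n : ℕ} {q : Fin n → K}
    {ψ : LR K n →ₐ[K] Localization (zS K n q)}
    (hV : ∀ i, ψ (V K n i) =
      -algebraMap (MvPolynomial (Fin n) K) (Localization (zS K n q)) (zP K n q i))
    (hP : ∀ p, ∃ x, ψ x = algebraMap (MvPolynomial (Fin n) K) (Localization (zS K n q)) p) :
    Function.Surjective ψ := by
  intro y
  obtain ⟨⟨p, s, α, m, hα, rfl⟩, hy⟩ := IsLocalization.surj (zS K n q) y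
  obtain ⟨x, hx⟩ := hP p
  have hw : IsUnit (algebraMap K (LR K n) α * ∏ i, (-V K n i) ^ m i) :=
    ((IsUnit.mk0 α hα).map _).mul
      ((Submonoid.prod_mem (IsUnit.submonoid _)) fun i _ => (isUnit_mon K n _).neg.pow _)
  obtain ⟨w, hw⟩ := hw
  have hψw : ψ w = algebraMap (MvPolynomial (Fin n) K) (Localization (zS K n q))
      (α • ∏ i, zP K n q i ^ m i) := by
    rw [hw, Algebra.smul_def, map_mul, map_mul, AlgHom.commutes,
      ← IsScalarTower.algebraMap_apply, map_prod, map_prod]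
    simp [hV]
  refine ⟨x * ↑w⁻¹, ?_⟩
  rw [map_mul, hx, ← hy, ← hψw, mul_assoc, ← map_mul, Units.mul_inv, map_one, mul_one]

open MvPolynomial in
/-- The `z_i` are invertible in `S^{-1}P`; there is a unique
`K`-algebra homomorphism `ψ : R → S^{-1}P` with `ψ(u_i) = −q_i^{-1} z_{i−1}` and
`ψ(v_i) = −z_i`; moreover `ψ` is surjective, `ℤ^n`-equivariant
(`ψ∘σ_i = τ̃_i∘ψ`), and `ψ(t_i) = s_i`. -/
theorem statement19
    (K : Type) [Field K] (n : ℕ) (q : Fin n → K) (hq : ∀ i, q i ≠ 0)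
    (hqroot : ∀ i, ∀ m : ℕ, 0 < m → q i ^ m ≠ 1)
    (σ : Fin n → (LR K n ≃ₐ[K] LR K n))
    (hσu : ∀ i j, σ i (U K n j) = (if i < j then q i else 1) • U K n j)
    (hσv : ∀ i j, σ i (V K n j) = (if i ≤ j then q i else 1) • V K n j)
    (τ : Fin n → (MvPolynomial (Fin n) K ≃ₐ[K] MvPolynomial (Fin n) K))
    (hτ : ∀ i j, τ i (X j) =
      if j < i then X j
      else if j = i then
        1 + C (q i) * X i + ∑ l ∈ Finset.univ.filter (fun l => l < i), C (q l - 1) * X l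
      else C (q i) * X j)
    (τt : Fin n → (Localization (zS K n q) ≃ₐ[K] Localization (zS K n q)))
    (hτt : ∀ i p, τt i (algebraMap (MvPolynomial (Fin n) K) (Localization (zS K n q)) p) =
      algebraMap (MvPolynomial (Fin n) K) (Localization (zS K n q)) (τ i p)) :
    (∀ i, IsUnit (algebraMap (MvPolynomial (Fin n) K) (Localization (zS K n q))
        (zP K n q i))) ∧
    (∃! ψ : LR K n →ₐ[K] Localization (zS K n q),
      (∀ i, ψ (U K n i) = -((q i)⁻¹ •
          algebraMap (MvPolynomial (Fin n) K) (Localization (zS K n q)) (zPrev K n q i))) ∧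
      (∀ i, ψ (V K n i) =
          -algebraMap (MvPolynomial (Fin n) K) (Localization (zS K n q)) (zP K n q i))) ∧
    (∀ ψ : LR K n →ₐ[K] Localization (zS K n q),
      ((∀ i, ψ (U K n i) = -((q i)⁻¹ •
          algebraMap (MvPolynomial (Fin n) K) (Localization (zS K n q)) (zPrev K n q i))) ∧
       (∀ i, ψ (V K n i) =
          -algebraMap (MvPolynomial (Fin n) K) (Localization (zS K n q)) (zP K n q i))) →
      Function.Surjective ψ ∧
      (∀ i x, ψ (σ i x) = τt i (ψ x)) ∧
      (∀ i, ψ (tQ K n q i) =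
        algebraMap (MvPolynomial (Fin n) K) (Localization (zS K n q)) (X i))) := by
  set A := algebraMap (MvPolynomial (Fin n) K) (Localization (zS K n q))
  have hC (c : K) (p : MvPolynomial (Fin n) K) : A (C c * p) = c • A p := by
    rw [← smul_eq_C_mul, Algebra.smul_def, map_mul, ← IsScalarTower.algebraMap_apply,
      ← Algebra.smul_def]
  have hz (i) : IsUnit (A (zP K n q i)) :=
    IsLocalization.map_units (Localization (zS K n q)) ⟨_, zP_mem_zS K n q i⟩
  have hz' (i) : IsUnit (-((q i)⁻¹ • A (zPrev K n q i))) := by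
    rw [Algebra.smul_def]
    exact (((IsUnit.mk0 _ (inv_ne_zero (hq i))).map _).mul
      (IsLocalization.map_units (Localization (zS K n q)) ⟨_, zPrev_mem_zS K n q i⟩)).neg
  refine ⟨hz, ?_, ?_⟩
  · obtain ⟨ψ, hU, hV⟩ := exists_LR_algHom (K := K) (fun i => (hz' i).unit)
      (fun i => (hz i).neg.unit)
    refine ⟨ψ, ⟨hU, hV⟩, fun φ hφ => LR_algHom_ext (fun i => ?_) (fun i => ?_)⟩
    · rw [hφ.1, hU, IsUnit.unit_spec]
    · rw [hφ.2, hV, IsUnit.unit_spec]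
  rintro ψ ⟨hU, hV⟩
  have ht (i) : ψ (tQ K n q i) = A (X i) := by
    have hq1 : q i - 1 ≠ 0 := sub_ne_zero.2 (by simpa using hqroot i 1 one_pos)
    have hc : (1 - (q i)⁻¹)⁻¹ * ((q i)⁻¹ * (q i - 1)) = 1 := by
      have := hq i
      rw [mul_sub, inv_mul_cancel₀ this, mul_one]
      refine inv_mul_cancel₀ fun h => hq1 ?_
      rw [← mul_inv_cancel₀ this, ← sub_one_mul] at h
      exact (mul_eq_zero.1 h).resolve_right (inv_ne_zero this)
    rw [tQ, map_smul, map_sub, map_smul, hU, hV, smul_neg, neg_sub_neg, zP_eq_zPrev_add, map_add,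
      hC, smul_add, add_sub_cancel_left, smul_smul, smul_smul, mul_assoc, hc, one_smul]
  refine ⟨surjective_of_map_V hV fun p => ?_, fun i => ?_, ht⟩
  · refine ⟨aeval (tQ K n q) p, ?_⟩
    have : ψ.comp (aeval (tQ K n q)) = IsScalarTower.toAlgHom K _ _ :=
      MvPolynomial.algHom_ext fun i => by simpa using ht i
    exact DFunLike.congr_fun this p
  · have hlt : ∀ j < i, τ i (X j) = X j := fun j hj => by rw [hτ, if_pos hj]
    have heq : τ i (X i) = zPrev K n q i + C (q i) * X i := by
      rw [hτ, if_neg (lt_irrefl i), if_pos rfl, zPrev_eq_sum]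
      ring
    have hgt : ∀ j, i < j → τ i (X j) = C (q i) * X j := fun j hj => by
      rw [hτ, if_neg hj.not_gt, if_neg hj.ne']
    have : ψ.comp (σ i).toAlgHom = (τt i).toAlgHom.comp ψ := by
      refine LR_algHom_ext (fun j => ?_) (fun j => ?_)
      · change ψ (σ i (U K n j)) = τt i (ψ (U K n j))
        rw [hσu, map_smul, hU, map_neg, map_smul, hτt]
        split_ifs with h
        · rw [tau_zPrev_of_lt hlt heq hgt h, hC, smul_neg, smul_comm]
        · rw [tau_zPrev_of_le hlt (not_lt.1 h), one_smul]
      · change ψ (σ i (V K n j)) = τt i (ψ (V K n j))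
        rw [hσv, map_smul, hV, map_neg, hτt]
        split_ifs with h
        · rw [tau_zP_of_le hlt heq hgt h, hC, smul_neg]
        · rw [tau_zP_of_lt hlt (not_le.1 h), one_smul]
    exact DFunLike.congr_fun this

end MTW
end
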